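/- arXiv:1402.0398 — 2 statements merged into one kernel-verified Lean document; each statement's English description precedes it below -/
import Mathlib

section
/- For every integer r ≥ 1 there exists n_r ∈ ℕ such that for all N ≥ n_r one has M̄_r^+(N) − N̄_r^+(N) > 0; equivalently, the r-th ospt-function for overpartitions, ospt̄_r(N) := M̄_r^+(N) − N̄_r^+(N), is positive for all sufficiently large N. -/
open scoped BigOperators
open Filter MeasureTheory

/-- An overpartition of `n`: a partition of `n` in which the first occurrence of
each part size may be overlined.  We encode it as a finite set of (distinct)
overlined parts together with a multiset of non-overlined parts, all positive,
with total sum `n`. -/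
structure Overpartition (n : ℕ) where
  overlined : Finset ℕ
  nonoverlined : Multiset ℕ
  overlined_pos : ∀ i ∈ overlined, 0 < i
  nonoverlined_pos : ∀ i ∈ nonoverlined, 0 < i
  total : (overlined.sum id) + nonoverlined.sum = n

namespace Overpartition

/-- The multiset of all parts of an overpartition. -/
def parts {n : ℕ} (p : Overpartition n) : Multiset ℕ := p.overlined.val + p.nonoverlined

/-- Dyson's rank of an overpartition: largest part minus number of parts. -/
def rank {n : ℕ} (p : Overpartition n) : ℤ :=
  (p.parts.sup : ℤ) - (Multiset.card p.parts : ℤ)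

end Overpartition

/-- The crank of a partition (given as a multiset of positive parts):
the largest part if there are no 1's, and otherwise `μ(λ) - o(λ)` where `o(λ)`
is the number of 1's and `μ(λ)` is the number of parts larger than `o(λ)`. -/
def multisetCrank (s : Multiset ℕ) : ℤ :=
  if s.count 1 = 0 then (s.sup : ℤ)
  else ((s.filter (fun part => s.count 1 < part)).card : ℤ) - (s.count 1 : ℤ)

/-- The first residual crank of an overpartition: the crank of the subpartition
consisting of the non-overlined parts. -/
def Overpartition.crank {n : ℕ} (p : Overpartition n) : ℤ := multisetCrank p.nonoverlined

/-- `Mbar m n` is the number of overpartitions of `n` with first residual crank `m`. -/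
noncomputable def Mbar (m : ℤ) (n : ℕ) : ℕ :=
  Nat.card {p : Overpartition n // p.crank = m}

/-- `Nbar m n` is the number of overpartitions of `n` with Dyson rank `m`. -/
noncomputable def Nbar (m : ℤ) (n : ℕ) : ℕ :=
  Nat.card {p : Overpartition n // p.rank = m}

/-- The `r`-th positive crank moment `M̄_r^+(N) = Σ_{m ≥ 1} m^r M̄(m,N)`. -/
noncomputable def Mplus (r N : ℕ) : ℝ :=
  ∑' m : ℕ, ((m : ℝ) + 1) ^ r * (Mbar ((m : ℤ) + 1) N : ℝ)

/-- The `r`-th positive rank moment `N̄_r^+(N) = Σ_{m ≥ 1} m^r N̄(m,N)`. -/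
noncomputable def Nplus (r N : ℕ) : ℝ :=
  ∑' m : ℕ, ((m : ℝ) + 1) ^ r * (Nbar ((m : ℤ) + 1) N : ℝ)

/-- Positive symmetrized crank moment `μ̄_r^+(n) = Σ_{m ≥ 1} C(m + ⌊(r-1)/2⌋, r) M̄(m,n)`. -/
noncomputable def mubar (r n : ℕ) : ℝ :=
  ∑' m : ℕ, (Nat.choose (m + 1 + (r - 1) / 2) r : ℝ) * (Mbar ((m : ℤ) + 1) n : ℝ)

/-- Positive symmetrized rank moment `η̄_r^+(n) = Σ_{m ≥ 1} C(m + ⌊(r-1)/2⌋, r) N̄(m,n)`. -/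
noncomputable def etabar (r n : ℕ) : ℝ :=
  ∑' m : ℕ, (Nat.choose (m + 1 + (r - 1) / 2) r : ℝ) * (Nbar ((m : ℤ) + 1) n : ℝ)

/-- The Dirichlet eta function at positive integers:
`η(1) = log 2` and `η(r) = (1 - 2^{1-r}) ζ(r)` for `r ≥ 2`. -/
noncomputable def dirichletEtaNat (r : ℕ) : ℝ :=
  if r = 1 then Real.log 2 else (1 - 2 ^ (1 - (r : ℝ))) * (riemannZeta r).re

/-- The infinite Pochhammer symbol `(a; q)_∞ = Π_{j ≥ 0} (1 - a q^j)`. -/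
noncomputable def poch (a q : ℂ) : ℂ := ∏' j : ℕ, (1 - a * q ^ j)

/-- The (integral) exponent `n²/2 + (r/2 + ρ_C(r)) n`, where `ρ_C(r) = 0` for odd `r`
and `1/2` for even `r`. -/
def eC (r n : ℕ) : ℕ := (n * n + r * n + (if r % 2 = 0 then n else 0)) / 2

/-- The (integral) exponent `n² + (r/2 + ρ_R(r)) n`, where `ρ_R(r) = 1/2` for odd `r`
and `1` for even `r`. -/
def eR (r n : ℕ) : ℕ := (2 * n * n + r * n + (if r % 2 = 1 then n else 2 * n)) / 2

/-- `S_r(q) = Σ_{n ≥ 1} (-1)^{n+1} q^{n²/2 + (r/2 + ρ_C(r)) n} / (1 - q^n)^r`. -/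
noncomputable def Sr (r : ℕ) (q : ℂ) : ℂ :=
  ∑' n : ℕ, (-1 : ℂ) ^ n * q ^ eC r (n + 1) / (1 - q ^ (n + 1)) ^ r

/-- `S̃_r(q) = Σ_{n ≥ 1} (-1)^{n+1} q^{n² + (r/2 + ρ_R(r)) n} / ((1 - q^n)^r (1 + q^n))`. -/
noncomputable def Str (r : ℕ) (q : ℂ) : ℂ :=
  ∑' n : ℕ, (-1 : ℂ) ^ n * q ^ eR r (n + 1) / ((1 - q ^ (n + 1)) ^ r * (1 + q ^ (n + 1)))

/-- `SC_r(q) = ((-q;q)_∞/(q;q)_∞) S_r(q)`, the generating function of the positive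
symmetrized crank moments. -/
noncomputable def SCr (r : ℕ) (q : ℂ) : ℂ := (poch (-q) q / poch q q) * Sr r q

/-- `SR_r(q) = 2 ((-q;q)_∞/(q;q)_∞) S̃_r(q)`, the generating function of the positive
symmetrized rank moments. -/
noncomputable def SRr (r : ℕ) (q : ℂ) : ℂ := 2 * (poch (-q) q / poch q q) * Str r q

/-- `c_r = ζ(r) (1 - 2^{1-r})`. -/
noncomputable def cconst (r : ℕ) : ℂ := riemannZeta r * (1 - 2 ^ (1 - (r : ℂ)))

/-- `d_r = -(ζ(r-2)(1-2^{3-r})/2 + ρ_C(r) ζ(r-1)(1-2^{1-r}))`. -/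
noncomputable def dconst (r : ℕ) : ℂ :=
  -(riemannZeta ((r : ℂ) - 2) * (1 - 2 ^ (3 - (r : ℂ))) / 2 +
    (if r % 2 = 0 then (1 : ℂ) / 2 else 0) * riemannZeta ((r : ℂ) - 1) * (1 - 2 ^ (1 - (r : ℂ))))

/-- `d'_r = -(ζ(r-2)(1-2^{3-r}) + (ρ_R(r)/2) ζ(r-1)(1-2^{1-r}))`. -/
noncomputable def dconst' (r : ℕ) : ℂ :=
  -(riemannZeta ((r : ℂ) - 2) * (1 - 2 ^ (3 - (r : ℂ))) +
    (if r % 2 = 1 then (1 : ℂ) / 4 else (1 : ℂ) / 2) * riemannZeta ((r : ℂ) - 1) *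
      (1 - 2 ^ (1 - (r : ℂ))))

/-- The modified Bessel function of the first kind,
`I_s(x) = Σ_{k ≥ 0} (x/2)^{2k+s} / (k! Γ(k+s+1))`. -/
noncomputable def besselI (s x : ℝ) : ℝ :=
  ∑' k : ℕ, (x / 2) ^ (2 * (k : ℝ) + s) / ((k.factorial : ℝ) * Real.Gamma ((k : ℝ) + s + 1))

/-- The point `τ = x + i y` in the upper half plane. -/
noncomputable def mkTau (x y : ℝ) : ℂ := (x : ℂ) + (y : ℂ) * Complex.I

namespace Ospt

open PowerSeries Finset

/-- all multisets of positive integers with sum `n` -/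
noncomputable def PM (n : ℕ) : Finset (Multiset ℕ) :=
  (Finset.univ : Finset (Nat.Partition n)).image (fun p => p.parts)

lemma mem_PM {n : ℕ} {M : Multiset ℕ} : M ∈ PM n ↔ (∀ i ∈ M, 0 < i) ∧ M.sum = n := by
  classical
  unfold PM
  simp only [Finset.mem_image, Finset.mem_univ, true_and]
  constructor
  · rintro ⟨p, rfl⟩
    exact ⟨fun i hi => p.parts_pos hi, p.parts_sum⟩
  · rintro ⟨h1, h2⟩
    exact ⟨⟨M, fun {i} hi => h1 i hi, h2⟩, rfl⟩

/-- all finite sets of positive integers with sum `n` -/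
def DF (n : ℕ) : Finset (Finset ℕ) :=
  (Finset.Icc 1 n).powerset.filter (fun O => O.sum id = n)

lemma mem_DF {n : ℕ} {O : Finset ℕ} : O ∈ DF n ↔ (∀ i ∈ O, 0 < i) ∧ O.sum id = n := by
  unfold DF
  simp only [Finset.mem_filter, Finset.mem_powerset]
  constructor
  · rintro ⟨h1, h2⟩
    exact ⟨fun i hi => by have := Finset.mem_Icc.1 (h1 hi); omega, h2⟩
  · rintro ⟨h1, h2⟩
    refine ⟨fun i hi => Finset.mem_Icc.2 ⟨h1 i hi, ?_⟩, h2⟩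
    rw [← h2]
    exact Finset.single_le_sum (f := id) (fun _ _ => Nat.zero_le _) hi

open Classical in
/-- generating function of multisets with a property -/
noncomputable def mgf (p : Multiset ℕ → Prop) : ℤ⟦X⟧ :=
  PowerSeries.mk fun n => (((PM n).filter p).card : ℤ)

open Classical in
/-- generating function of finite sets with a property -/
noncomputable def fgf (p : Finset ℕ → Prop) : ℤ⟦X⟧ :=
  PowerSeries.mk fun n => (((DF n).filter p).card : ℤ)

/-- coefficientwise nonnegativity -/
def NN (f : ℤ⟦X⟧) : Prop := ∀ n, 0 ≤ coeff n f

lemma NN_mgf (p) : NN (mgf p) := fun n => by simp [mgf]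
lemma NN_fgf (p) : NN (fgf p) := fun n => by simp [fgf]
lemma NN.add {f g : ℤ⟦X⟧} (hf : NN f) (hg : NN g) : NN (f + g) := fun n => by
  simpa using add_nonneg (hf n) (hg n)
lemma NN.mul {f g : ℤ⟦X⟧} (hf : NN f) (hg : NN g) : NN (f * g) := fun n => by
  rw [coeff_mul]; exact Finset.sum_nonneg fun x _ => mul_nonneg (hf _) (hg _)
lemma NN_X_pow (k : ℕ) : NN ((X : ℤ⟦X⟧) ^ k) := fun n => by
  rw [coeff_X_pow]; split <;> simp
lemma NN_one : NN (1 : ℤ⟦X⟧) := by simpa using NN_X_pow 0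
lemma NN_zero : NN (0 : ℤ⟦X⟧) := fun n => by simp
lemma NN_sum {ι : Type*} (s : Finset ι) (f : ι → ℤ⟦X⟧) (h : ∀ i ∈ s, NN (f i)) :
    NN (∑ i ∈ s, f i) := fun n => by
  rw [map_sum]; exact Finset.sum_nonneg fun i hi => h i hi n

/-- a bijection with shift by `c`: `p`-multisets of `n` correspond to `q`-multisets of `n+c(card)` -/
lemma mgf_shift (p q : Multiset ℕ → Prop) (c : ℕ) (f g : Multiset ℕ → Multiset ℕ)
    (hf : ∀ M, (∀ i ∈ M, 0 < i) → p M → (∀ i ∈ f M, 0 < i) ∧ q (f M) ∧ (f M).sum = M.sum + c ∧ g (f M) = M)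
    (hg : ∀ M, (∀ i ∈ M, 0 < i) → q M → (∀ i ∈ g M, 0 < i) ∧ p (g M) ∧ M.sum = (g M).sum + c ∧ f (g M) = M) :
    mgf q = X ^ c * mgf p := by
  classical
  ext n
  rw [coeff_X_pow_mul']
  simp only [mgf, coeff_mk]
  split_ifs with h
  · congr 1
    symm
    refine Finset.card_nbij' f g ?_ ?_ ?_ ?_
    · intro M hM
      simp only [Finset.coe_filter, Set.mem_ofPred_eq, mem_PM] at hM ⊢
      obtain ⟨a, b, c', d⟩ := hf M hM.1.1 hM.2
      exact ⟨⟨a, by omega⟩, b⟩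
    · intro M hM
      simp only [Finset.coe_filter, Set.mem_ofPred_eq, mem_PM] at hM ⊢
      obtain ⟨a, b, c', d⟩ := hg M hM.1.1 hM.2
      exact ⟨⟨a, by omega⟩, b⟩
    · intro M hM
      simp only [Finset.coe_filter, Set.mem_ofPred_eq, mem_PM] at hM
      exact (hf M hM.1.1 hM.2).2.2.2
    · intro M hM
      simp only [Finset.coe_filter, Set.mem_ofPred_eq, mem_PM] at hM
      exact (hg M hM.1.1 hM.2).2.2.2
  · simp only [Nat.cast_eq_zero, Finset.card_eq_zero]
    apply Finset.filter_eq_empty_iff.2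
    intro M hM hq
    rw [mem_PM] at hM
    have := (hg M hM.1 hq).2.2.1
    omega

lemma fgf_shift (p q : Finset ℕ → Prop) (c : ℕ) (f g : Finset ℕ → Finset ℕ)
    (hf : ∀ M, (∀ i ∈ M, 0 < i) → p M → (∀ i ∈ f M, 0 < i) ∧ q (f M) ∧ (f M).sum id = M.sum id + c ∧ g (f M) = M)
    (hg : ∀ M, (∀ i ∈ M, 0 < i) → q M → (∀ i ∈ g M, 0 < i) ∧ p (g M) ∧ M.sum id = (g M).sum id + c ∧ f (g M) = M) :
    fgf q = X ^ c * fgf p := by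
  classical
  ext n
  rw [coeff_X_pow_mul']
  simp only [fgf, coeff_mk]
  split_ifs with h
  · congr 1
    symm
    refine Finset.card_nbij' f g ?_ ?_ ?_ ?_
    · intro M hM
      simp only [Finset.coe_filter, Set.mem_ofPred_eq, mem_DF] at hM ⊢
      obtain ⟨a, b, c', d⟩ := hf M hM.1.1 hM.2
      exact ⟨⟨a, by omega⟩, b⟩
    · intro M hM
      simp only [Finset.coe_filter, Set.mem_ofPred_eq, mem_DF] at hM ⊢
      obtain ⟨a, b, c', d⟩ := hg M hM.1.1 hM.2
      exact ⟨⟨a, by omega⟩, b⟩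
    · intro M hM
      simp only [Finset.coe_filter, Set.mem_ofPred_eq, mem_DF] at hM
      exact (hf M hM.1.1 hM.2).2.2.2
    · intro M hM
      simp only [Finset.coe_filter, Set.mem_ofPred_eq, mem_DF] at hM
      exact (hg M hM.1.1 hM.2).2.2.2
  · simp only [Nat.cast_eq_zero, Finset.card_eq_zero]
    apply Finset.filter_eq_empty_iff.2
    intro M hM hq
    rw [mem_DF] at hM
    have := (hg M hM.1 hq).2.2.1
    omega

lemma mgf_split (p r : Multiset ℕ → Prop) :
    mgf p = mgf (fun M => p M ∧ r M) + mgf (fun M => p M ∧ ¬ r M) := by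
  classical
  ext n
  simp only [mgf, coeff_mk, map_add]
  have h := (Finset.card_filter_add_card_filter_not (s := (PM n).filter p) r).symm
  rw [Finset.filter_filter, Finset.filter_filter] at h
  rw [← Nat.cast_add]
  norm_cast
  convert h using 3 <;> (ext; simp)

lemma fgf_split (p r : Finset ℕ → Prop) :
    fgf p = fgf (fun M => p M ∧ r M) + fgf (fun M => p M ∧ ¬ r M) := by
  classical
  ext n
  simp only [fgf, coeff_mk, map_add]
  have h := (Finset.card_filter_add_card_filter_not (s := (DF n).filter p) r).symm
  rw [Finset.filter_filter, Finset.filter_filter] at h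
  rw [← Nat.cast_add]
  norm_cast
  convert h using 3 <;> (ext; simp)

lemma mgf_congr {p q : Multiset ℕ → Prop} (h : ∀ M, (∀ i ∈ M, 0 < i) → (p M ↔ q M)) :
    mgf p = mgf q := by
  classical
  ext n
  simp only [mgf, coeff_mk]
  congr 2
  apply Finset.filter_congr
  intro M hM
  exact h M (mem_PM.1 hM).1

lemma fgf_congr {p q : Finset ℕ → Prop} (h : ∀ M, (∀ i ∈ M, 0 < i) → (p M ↔ q M)) :
    fgf p = fgf q := by
  classical
  ext n
  simp only [fgf, coeff_mk]
  congr 2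
  apply Finset.filter_congr
  intro M hM
  exact h M (mem_DF.1 hM).1

/-- multisets with parts in `B` -/
noncomputable def FB (B : Set ℕ) : ℤ⟦X⟧ := mgf (fun M => ∀ i ∈ M, i ∈ B)
/-- finite sets with elements in `A` -/
noncomputable def DA (A : Set ℕ) : ℤ⟦X⟧ := fgf (fun M => ∀ i ∈ M, i ∈ A)

lemma FB_insert {b : ℕ} (hb : 0 < b) {B : Set ℕ} (h : b ∉ B) :
    (1 - X ^ b) * FB (insert b B) = FB B := by
  have h1 := mgf_split (fun M => ∀ i ∈ M, i ∈ insert b B) (fun M => b ∈ M)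
  have h2 : mgf (fun M => (∀ i ∈ M, i ∈ insert b B) ∧ b ∈ M) = X ^ b * FB (insert b B) := by
    refine mgf_shift _ _ b (fun M => b ::ₘ M) (fun M => M.erase b) ?_ ?_
    · intro M h0 hM
      refine ⟨?_, ⟨?_, by simp⟩, by simp [add_comm], by simp⟩
      · intro i hi; rcases Multiset.mem_cons.1 hi with rfl | hi; exacts [hb, h0 i hi]
      · intro i hi; rcases Multiset.mem_cons.1 hi with rfl | hi; exacts [Set.mem_insert _ _, hM i hi]
    · rintro M h0 ⟨hM, hbM⟩
      refine ⟨fun i hi => h0 i (Multiset.mem_of_mem_erase hi),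
        fun i hi => hM i (Multiset.mem_of_mem_erase hi), ?_, Multiset.cons_erase hbM⟩
      conv_lhs => rw [← Multiset.cons_erase hbM]
      simp [add_comm]
  have h3 : mgf (fun M => (∀ i ∈ M, i ∈ insert b B) ∧ ¬ b ∈ M) = FB B := by
    refine mgf_congr ?_
    intro M _
    constructor
    · rintro ⟨h1, h2⟩ i hi
      rcases h1 i hi with rfl | h
      exacts [absurd hi h2, h]
    · intro hM
      exact ⟨fun i hi => Set.mem_insert_of_mem _ (hM i hi), fun hb => h (hM b hb)⟩
  rw [h2, h3] at h1
  have : FB (insert b B) = X ^ b * FB (insert b B) + FB B := h1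
  linear_combination this

lemma DA_insert {b : ℕ} (hb : 0 < b) {B : Set ℕ} (h : b ∉ B) :
    DA (insert b B) = (1 + X ^ b) * DA B := by
  classical
  have h1 := fgf_split (fun M => ∀ i ∈ M, i ∈ insert b B) (fun M => b ∈ M)
  have h2 : fgf (fun M => (∀ i ∈ M, i ∈ insert b B) ∧ b ∈ M) = X ^ b * DA B := by
    refine fgf_shift _ _ b (fun M => insert b M) (fun M => M.erase b) ?_ ?_
    · intro M h0 hM
      have hbM : b ∉ M := fun hb => h (hM b hb)
      refine ⟨?_, ⟨?_, by simp⟩, by rw [Finset.sum_insert hbM]; simp [add_comm], by simp [hbM]⟩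
      · intro i hi; rcases Finset.mem_insert.1 hi with rfl | hi; exacts [hb, h0 i hi]
      · intro i hi; rcases Finset.mem_insert.1 hi with rfl | hi; exacts [Set.mem_insert _ _, Set.mem_insert_of_mem _ (hM i hi)]
    · rintro M h0 ⟨hM, hbM⟩
      refine ⟨fun i hi => h0 i (Finset.mem_of_mem_erase hi), ?_, ?_, Finset.insert_erase hbM⟩
      · intro i hi
        rcases hM i (Finset.mem_of_mem_erase hi) with rfl | h'
        · simp at hi
        · exact h'
      · rw [← Finset.sum_erase_add _ _ hbM]; simp
  have h3 : fgf (fun M => (∀ i ∈ M, i ∈ insert b B) ∧ ¬ b ∈ M) = DA B := by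
    refine fgf_congr ?_
    intro M _
    constructor
    · rintro ⟨h1, h2⟩ i hi
      rcases h1 i hi with rfl | h
      exacts [absurd hi h2, h]
    · intro hM
      exact ⟨fun i hi => Set.mem_insert_of_mem _ (hM i hi), fun hb => h (hM b hb)⟩
  rw [h2, h3] at h1
  have : DA (insert b B) = X ^ b * DA B + DA B := h1
  linear_combination this

lemma FB_remove {b : ℕ} (hb : 0 < b) {B : Set ℕ} (h : b ∈ B) :
    (1 - X ^ b) * FB B = FB (B \ {b}) := by
  have := FB_insert hb (B := B \ {b}) (by simp)
  rwa [Set.insert_sdiff_singleton, Set.insert_eq_of_mem h] at this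

lemma DA_remove {b : ℕ} (hb : 0 < b) {B : Set ℕ} (h : b ∈ B) :
    DA B = (1 + X ^ b) * DA (B \ {b}) := by
  have := DA_insert hb (B := B \ {b}) (by simp)
  rwa [Set.insert_sdiff_singleton, Set.insert_eq_of_mem h] at this

end Ospt

namespace Ospt

open PowerSeries Finset

/-- formal infinite sum -/
noncomputable def ssum (τ : ℕ → ℤ⟦X⟧) : ℤ⟦X⟧ :=
  PowerSeries.mk fun n => ∑ i ∈ Finset.range (n + 1), coeff n (τ i)

lemma ssum_spec (τ : ℕ → ℤ⟦X⟧) (h : ∀ i, (X : ℤ⟦X⟧) ^ i ∣ τ i) (M : ℕ) :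
    (X : ℤ⟦X⟧) ^ M ∣ ssum τ - ∑ i ∈ Finset.range M, τ i := by
  rw [PowerSeries.X_pow_dvd_iff]
  intro m hm
  rw [map_sub, map_sum, ssum, coeff_mk, sub_eq_zero]
  refine Finset.sum_subset (Finset.range_subset_range.2 hm) ?_
  intro i _ hi
  rw [Finset.mem_range, not_lt] at hi
  exact PowerSeries.X_pow_dvd_iff.1 (h i) m (by omega)

lemma eq_of_X_pow_dvd {f g : ℤ⟦X⟧} (h : ∀ M : ℕ, (X : ℤ⟦X⟧) ^ M ∣ f - g) : f = g := by
  ext n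
  have := PowerSeries.X_pow_dvd_iff.1 (h (n + 1)) n (by omega)
  rw [map_sub] at this
  omega

lemma eq_ssum (f : ℤ⟦X⟧) (τ : ℕ → ℤ⟦X⟧)
    (h : ∀ M : ℕ, (X : ℤ⟦X⟧) ^ M ∣ f - ∑ i ∈ Finset.range M, τ i)
    (h' : ∀ i, (X : ℤ⟦X⟧) ^ i ∣ τ i) : f = ssum τ := by
  apply eq_of_X_pow_dvd
  intro M
  have := dvd_sub (h M) (ssum_spec τ h' M)
  simpa using this

lemma mgf_fiber (p : Multiset ℕ → Prop) :
    mgf p = ssum (fun o => mgf (fun M => p M ∧ M.count 1 = o)) := by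
  classical
  ext n
  simp only [mgf, ssum, coeff_mk]
  rw [Finset.card_eq_sum_card_fiberwise (f := fun M => M.count 1) (t := Finset.range (n + 1))]
  · push_cast
    refine Finset.sum_congr rfl fun o _ => ?_
    rw [Finset.filter_filter]
    congr 2
    ext; simp
  · intro M hM
    simp only [Finset.coe_filter, Set.mem_ofPred_eq, mem_PM] at hM
    simp only [Finset.coe_range, Set.mem_Iio]
    have h1 : M.count 1 ≤ M.sum := by
      have h2 : (Multiset.replicate (M.count 1) 1).sum ≤ M.sum :=
        by
          obtain ⟨u, hu⟩ := Multiset.le_iff_exists_add.1 (Multiset.le_count_iff_replicate_le.1 (le_refl (M.count 1)))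
          conv_rhs => rw [hu, Multiset.sum_add]
          exact Nat.le_add_right _ _
      simpa using h2
    have := hM.1.2
    omega

lemma mgf_prod (o : ℕ) (p r : Multiset ℕ → Prop) :
    mgf (fun M => p (M.filter (· ≤ o)) ∧ r (M.filter (fun i => ¬ i ≤ o))) =
      mgf (fun M => p M ∧ ∀ i ∈ M, i ≤ o) * mgf (fun M => r M ∧ ∀ i ∈ M, o < i) := by
  classical
  ext n
  rw [coeff_mul]
  simp only [mgf, coeff_mk]
  simp_rw [← Nat.cast_mul, ← Nat.cast_sum, ← Finset.card_product]
  rw [← Finset.card_sigma]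
  congr 1
  refine Finset.card_nbij'
    (fun M => ⟨((M.filter (· ≤ o)).sum, (M.filter (fun i => ¬ i ≤ o)).sum),
      (M.filter (· ≤ o), M.filter (fun i => ¬ i ≤ o))⟩) (fun x => x.2.1 + x.2.2) ?_ ?_ ?_ ?_
  · intro M hM
    simp only [Finset.coe_filter, Set.mem_ofPred_eq, mem_PM] at hM
    simp only [Finset.coe_sigma, Set.mem_sigma_iff, Finset.mem_coe, Finset.HasAntidiagonal.mem_antidiagonal,
      Finset.mem_product, Finset.mem_filter, mem_PM]
    refine ⟨?_, ⟨⟨fun i hi => hM.1.1 i (Multiset.mem_of_mem_filter hi), by trivial⟩, hM.2.1,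
      fun i hi => (Multiset.mem_filter.1 hi).2⟩, ⟨fun i hi => hM.1.1 i (Multiset.mem_of_mem_filter hi), by trivial⟩, hM.2.2,
      fun i hi => not_le.1 (Multiset.mem_filter.1 hi).2⟩
    rw [← Multiset.sum_add, Multiset.filter_add_not, hM.1.2]
  · rintro ⟨⟨a, b⟩, ⟨M, K⟩⟩ hM
    simp only [Finset.coe_sigma, Set.mem_sigma_iff, Finset.mem_coe, Finset.HasAntidiagonal.mem_antidiagonal,
      Finset.mem_product, Finset.mem_filter, mem_PM] at hM
    obtain ⟨hab, ⟨⟨h1, h2⟩, h3, h4⟩, ⟨h5, h6⟩, h7, h8⟩ := hM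
    have e1 : (M + K).filter (· ≤ o) = M := by
      rw [Multiset.filter_add, Multiset.filter_eq_self.2 h4,
        Multiset.filter_eq_nil.2 (fun i hi => not_le.2 (h8 i hi)), add_zero]
    have e2 : (M + K).filter (fun i => ¬ i ≤ o) = K := by
      rw [Multiset.filter_add, Multiset.filter_eq_self.2 (fun i hi => not_le.2 (h8 i hi)),
        Multiset.filter_eq_nil.2 (fun i hi => not_not.2 (h4 i hi)), zero_add]
    simp only [Finset.coe_filter, Set.mem_ofPred_eq, mem_PM, e1, e2]
    refine ⟨⟨?_, by rw [Multiset.sum_add, h2, h6, hab]⟩, h3, h7⟩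
    intro i hi
    rcases Multiset.mem_add.1 hi with hi | hi
    exacts [h1 i hi, h5 i hi]
  · intro M _
    exact Multiset.filter_add_not _ _
  · rintro ⟨⟨a, b⟩, ⟨M, K⟩⟩ hM
    simp only [Finset.coe_sigma, Set.mem_sigma_iff, Finset.mem_coe, Finset.HasAntidiagonal.mem_antidiagonal,
      Finset.mem_product, Finset.mem_filter, mem_PM] at hM
    obtain ⟨hab, ⟨⟨h1, h2⟩, h3, h4⟩, ⟨h5, h6⟩, h7, h8⟩ := hM
    have e1 : (M + K).filter (· ≤ o) = M := by
      rw [Multiset.filter_add, Multiset.filter_eq_self.2 h4,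
        Multiset.filter_eq_nil.2 (fun i hi => not_le.2 (h8 i hi)), add_zero]
    have e2 : (M + K).filter (fun i => ¬ i ≤ o) = K := by
      rw [Multiset.filter_add, Multiset.filter_eq_self.2 (fun i hi => not_le.2 (h8 i hi)),
        Multiset.filter_eq_nil.2 (fun i hi => not_not.2 (h4 i hi)), zero_add]
    simp only [e1, e2, h2, h6]

/-- `1/(q)_i` -/
noncomputable def Fi (i : ℕ) : ℤ⟦X⟧ := FB (Set.Icc 1 i)

lemma mgf_eq_zero_multiset : mgf (fun M => M = 0) = 1 := by
  classical
  ext n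
  simp only [mgf, coeff_mk, coeff_one]
  split_ifs with h
  · subst h
    have : (PM 0).filter (fun M => M = 0) = {0} := by
      ext M; simp only [Finset.mem_filter, mem_PM, Finset.mem_singleton]
      constructor
      · exact fun h => h.2
      · rintro rfl; simp
    have h2 : (Finset.filter (fun M => M = 0) (PM 0)).card = 1 := by rw [this]; simp
    convert congrArg (Nat.cast : ℕ → ℤ) h2
    simp
  · simp only [Nat.cast_eq_zero, Finset.card_eq_zero]
    refine Finset.eq_empty_of_forall_notMem fun M hM => ?_
    simp only [Finset.mem_filter, mem_PM] at hM
    obtain ⟨h1, rfl⟩ := hM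
    simp at h1; omega

lemma mgf_false (p : Multiset ℕ → Prop) (h : ∀ M, (∀ i ∈ M, 0 < i) → ¬ p M) : mgf p = 0 := by
  classical
  ext n
  simp only [mgf, coeff_mk, map_zero, Nat.cast_eq_zero, Finset.card_eq_zero]
  refine Finset.eq_empty_of_forall_notMem fun M hM => ?_
  obtain ⟨h1, h2⟩ := Finset.mem_filter.1 hM
  exact h M (mem_PM.1 h1).1 h2

lemma Fi_zero : Fi 0 = 1 := by
  rw [← mgf_eq_zero_multiset]
  refine mgf_congr fun M hM => ?_
  simp only [Set.mem_Icc]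
  constructor
  · intro h
    refine Multiset.eq_zero_of_forall_notMem fun i hi => ?_
    have := h i hi; omega
  · rintro rfl; simp

lemma Fi_succ (i : ℕ) : (1 - X ^ (i + 1)) * Fi (i + 1) = Fi i := by
  unfold Fi
  rw [FB_remove (Nat.succ_pos i) (by simp)]
  congr 1
  ext x; simp only [Set.mem_sdiff, Set.mem_Icc, Set.mem_singleton_iff]; omega

/-- multisets of `s` parts all `> o` -/
noncomputable def Js (s o : ℕ) : ℤ⟦X⟧ := mgf (fun M => M.card = s ∧ ∀ i ∈ M, o < i)

lemma Js_succ (s o : ℕ) : Js s (o + 1) = X ^ s * Js s o := by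
  refine mgf_shift _ _ s (Multiset.map (· + 1)) (Multiset.map (· - 1)) ?_ ?_
  · rintro M h0 ⟨h1, h2⟩
    refine ⟨?_, ⟨by simpa using h1, ?_⟩, ?_, ?_⟩
    · intro i hi; obtain ⟨j, hj, rfl⟩ := Multiset.mem_map.1 hi; omega
    · intro i hi; obtain ⟨j, hj, rfl⟩ := Multiset.mem_map.1 hi; have := h2 j hj; omega
    · rw [Multiset.sum_map_add]; simp [h1]
    · simp
  · rintro M h0 ⟨h1, h2⟩
    have e : Multiset.map (fun x => x + 1) (Multiset.map (fun x => x - 1) M) = M := by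
      rw [Multiset.map_map]
      conv_rhs => rw [← Multiset.map_id M]
      apply Multiset.map_congr rfl
      intro i hi; have := h0 i hi; simp; omega
    refine ⟨?_, ⟨by simpa using h1, ?_⟩, ?_, e⟩
    · intro i hi; obtain ⟨j, hj, rfl⟩ := Multiset.mem_map.1 hi; have := h2 j hj; omega
    · intro i hi; obtain ⟨j, hj, rfl⟩ := Multiset.mem_map.1 hi; have := h2 j hj; omega
    · conv_lhs => rw [← e]
      rw [Multiset.sum_map_add]; simp [h1]

lemma Js_zero_rec (s : ℕ) : Js (s + 1) 0 = Js (s + 1) 1 + X * Js s 0 := by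
  have h1 := mgf_split (fun M => M.card = s + 1 ∧ ∀ i ∈ M, 0 < i) (fun M => 1 ∈ M)
  have h2 : mgf (fun M => (M.card = s + 1 ∧ ∀ i ∈ M, 0 < i) ∧ 1 ∈ M) = X ^ 1 * Js s 0 := by
    refine mgf_shift _ _ 1 (fun M => 1 ::ₘ M) (fun M => M.erase 1) ?_ ?_
    · rintro M h0 ⟨hM, _⟩
      have : ∀ i ∈ 1 ::ₘ M, 0 < i := by
        intro i hi; rcases Multiset.mem_cons.1 hi with rfl | hi; exacts [one_pos, h0 i hi]
      exact ⟨this, ⟨⟨by simp [hM], this⟩, by simp⟩, by simp [add_comm], by simp⟩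
    · rintro M h0 ⟨⟨hM, _⟩, hbM⟩
      refine ⟨fun i hi => h0 i (Multiset.mem_of_mem_erase hi),
        ⟨by rw [Multiset.card_erase_of_mem hbM, hM]; rfl, fun i hi => h0 i (Multiset.mem_of_mem_erase hi)⟩, ?_, Multiset.cons_erase hbM⟩
      conv_lhs => rw [← Multiset.cons_erase hbM]
      simp [add_comm]
  have h3 : mgf (fun M => (M.card = s + 1 ∧ ∀ i ∈ M, 0 < i) ∧ ¬ 1 ∈ M) = Js (s + 1) 1 := by
    refine mgf_congr fun M hM => ?_
    constructor
    · rintro ⟨⟨h1, h2⟩, h3⟩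
      refine ⟨h1, fun i hi => ?_⟩
      have := h2 i hi
      have : i ≠ 1 := by rintro rfl; exact h3 hi
      omega
    · rintro ⟨h1, h2⟩
      exact ⟨⟨h1, hM⟩, fun h => absurd (h2 1 h) (lt_irrefl _)⟩
  rw [h2, h3] at h1
  have : Js (s + 1) 0 = X ^ 1 * Js s 0 + Js (s + 1) 1 := h1
  rw [this]; ring

lemma one_sub_ne_zero (k : ℕ) : (1 - X ^ (k + 1) : ℤ⟦X⟧) ≠ 0 := by
  intro h
  have := congrArg (coeff 0) h
  simp [coeff_X_pow] at this

lemma Js_zero_eq (s : ℕ) : Js s 0 = X ^ s * Fi s := by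
  induction s with
  | zero =>
    rw [Fi_zero, pow_zero, one_mul, ← mgf_eq_zero_multiset]
    refine mgf_congr fun M hM => ?_
    simp only [Multiset.card_eq_zero]
    exact ⟨fun h => h.1, fun h => ⟨h, hM⟩⟩
  | succ s ih =>
    have h1 := Js_zero_rec s
    have h2 := Js_succ (s + 1) 0
    have h3 := Fi_succ s
    rw [zero_add] at h2
    apply mul_left_cancel₀ (one_sub_ne_zero s)
    rw [h2, ih] at h1
    linear_combination h1 - X ^ (s + 1) * h3

lemma Js_eq (s o : ℕ) : Js s o = X ^ ((o + 1) * s) * Fi s := by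
  induction o with
  | zero => rw [Js_zero_eq]; ring
  | succ o ih => rw [Js_succ, ih]; ring

/-- crank generating function of partitions -/
noncomputable def cr (k : ℕ) : ℤ⟦X⟧ := mgf (fun M => multisetCrank M = k)

/-- the `o`-th term -/
noncomputable def crt (k o : ℕ) : ℤ⟦X⟧ :=
  (1 - X) * X ^ (o + (o + 1) * (k + o)) * Fi o * Fi (k + o)

lemma FB_two (o : ℕ) (ho : 1 ≤ o) : FB (Set.Icc 2 o) = (1 - X) * Fi o := by
  have := FB_remove (b := 1) one_pos (B := Set.Icc 1 o) (by simp [ho])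
  rw [pow_one] at this
  unfold Fi
  rw [this]
  congr 1
  ext x; simp only [Set.mem_sdiff, Set.mem_Icc, Set.mem_singleton_iff]; omega

lemma mgf_ones (o : ℕ) :
    mgf (fun M => M.count 1 = o ∧ ∀ i ∈ M, i ≤ o) = X ^ o * FB (Set.Icc 2 o) := by
  refine mgf_shift _ _ o (fun M => M + Multiset.replicate o 1) (fun M => M.filter (fun i => i ≠ 1)) ?_ ?_
  · intro M h0 hM
    have hc : M.count 1 = 0 := Multiset.count_eq_zero.2 fun h => by
      have := (hM 1 h).1; omega
    refine ⟨?_, ⟨by simp [hc], ?_⟩, by simp, ?_⟩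
    · intro i hi
      rcases Multiset.mem_add.1 hi with hi | hi
      exacts [h0 i hi, by rw [Multiset.eq_of_mem_replicate hi]; exact one_pos]
    · intro i hi
      rcases Multiset.mem_add.1 hi with hi | hi
      · exact (hM i hi).2
      · have := Multiset.mem_replicate.1 hi; omega
    · rw [Multiset.filter_add, Multiset.filter_eq_self.2, Multiset.filter_eq_nil.2, add_zero]
      · intro i hi; simp [Multiset.eq_of_mem_replicate hi]
      · intro i hi; have := (hM i hi).1; omega
  · rintro M h0 ⟨h1, h2⟩
    have e : M.filter (fun i => i ≠ 1) + Multiset.replicate o 1 = M := by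
      rw [← h1, ← Multiset.filter_eq' M 1, add_comm]
      exact Multiset.filter_add_not _ _
    refine ⟨fun i hi => h0 i (Multiset.mem_of_mem_filter hi), ?_, ?_, e⟩
    · intro i hi
      have h3 := Multiset.mem_filter.1 hi
      have := h0 i h3.1
      exact ⟨by omega, h2 i h3.1⟩
    · conv_lhs => rw [← e]
      simp

lemma cr_term (k o : ℕ) (hk : 1 ≤ k) (ho : 1 ≤ o) :
    mgf (fun M => multisetCrank M = k ∧ M.count 1 = o) = crt k o := by
  have h1 := mgf_prod o (fun M => M.count 1 = o) (fun M => M.card = k + o)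
  rw [mgf_ones, FB_two o ho] at h1
  have h2 : mgf (fun M => M.card = k + o ∧ ∀ i ∈ M, o < i) = X ^ ((o + 1) * (k + o)) * Fi (k + o) :=
    Js_eq _ _
  rw [h2] at h1
  have h3 : mgf (fun M => multisetCrank M = k ∧ M.count 1 = o) =
    mgf (fun M => (M.filter (· ≤ o)).count 1 = o ∧ (M.filter (fun i => ¬ i ≤ o)).card = k + o) := by
    refine mgf_congr fun M hM => ?_
    rw [Multiset.count_filter_of_pos (p := fun x => x ≤ o) (a := 1) ho]
    simp only [not_le, multisetCrank]
    constructor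
    · rintro ⟨h1, h2⟩
      rw [h2, if_neg (by omega)] at h1
      exact ⟨h2, by omega⟩
    · rintro ⟨h1, h2⟩
      rw [h1, if_neg (by omega)]
      exact ⟨by omega, rfl⟩
  rw [h3, h1, crt]
  ring

lemma cr_term_zero (k : ℕ) (hk : 1 ≤ k) :
    mgf (fun M => multisetCrank M = k ∧ M.count 1 = 0) + (if k = 1 then X else 0) = crt k 0 := by
  have h3 : mgf (fun M => multisetCrank M = k ∧ M.count 1 = 0) =
      mgf (fun M => M.sup = k ∧ M.count 1 = 0) := by
    refine mgf_congr fun M hM => ?_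
    constructor
    · rintro ⟨h1, h2⟩
      rw [multisetCrank, if_pos h2] at h1
      exact ⟨by exact_mod_cast h1, h2⟩
    · rintro ⟨h1, h2⟩
      rw [multisetCrank, if_pos h2]
      exact ⟨by exact_mod_cast h1, h2⟩
  have hsup : ∀ M : Multiset ℕ, M ≠ 0 → M.sup ∈ M := by
    intro M
    induction M using Multiset.induction_on with
    | empty => simp
    | cons a M ih =>
      intro _
      rw [Multiset.sup_cons]
      by_cases h : M = 0
      · subst h; simp
      · rcases le_total a M.sup with h' | h'
        · rw [sup_eq_right.2 h']; exact Multiset.mem_cons_of_mem (ih h)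
        · rw [sup_eq_left.2 h']; exact Multiset.mem_cons_self _ _
  rw [h3]
  by_cases hk1 : k = 1
  · subst hk1
    rw [if_pos rfl, mgf_false, crt, Fi_zero]
    · have := Fi_succ 0
      rw [Fi_zero] at this
      simp only [zero_add, add_zero, one_mul, pow_one, mul_one] at this ⊢
      linear_combination - X * this
    · rintro M hM ⟨h1, h2⟩
      have hM0 : M ≠ 0 := by rintro rfl; simp at h1
      have := hsup M hM0
      rw [h1] at this
      exact absurd this (Multiset.count_eq_zero.1 h2)
  · rw [if_neg hk1, add_zero]
    have : mgf (fun M => M.sup = k ∧ M.count 1 = 0) = X ^ k * FB (Set.Icc 2 k) := by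
      refine mgf_shift _ _ k (fun M => k ::ₘ M) (fun M => M.erase k) ?_ ?_
      · intro M h0 hM
        refine ⟨?_, ⟨?_, ?_⟩, by simp [add_comm], by simp⟩
        · intro i hi; rcases Multiset.mem_cons.1 hi with rfl | hi; exacts [hk, h0 i hi]
        · rw [Multiset.sup_cons]
          exact sup_eq_left.2 (Multiset.sup_le.2 fun i hi => (hM i hi).2)
        · rw [Multiset.count_cons_of_ne (Ne.symm hk1)]
          exact Multiset.count_eq_zero.2 fun h => by have := (hM 1 h).1; omega
      · rintro M h0 ⟨h1, h2⟩
        have hM0 : M ≠ 0 := by rintro rfl; simp at h1; omega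
        have hkM : k ∈ M := h1 ▸ hsup M hM0
        refine ⟨fun i hi => h0 i (Multiset.mem_of_mem_erase hi), ?_, ?_, Multiset.cons_erase hkM⟩
        · intro i hi
          have hi' := Multiset.mem_of_mem_erase hi
          have a1 := h0 i hi'
          have a2 : i ≠ 1 := by rintro rfl; exact Multiset.count_eq_zero.1 h2 hi'
          have a3 : i ≤ k := h1 ▸ Multiset.le_sup hi'
          exact ⟨by omega, a3⟩
        · conv_lhs => rw [← Multiset.cons_erase hkM]
          simp [add_comm]
    rw [this, FB_two k hk, crt, Fi_zero]
    simp only [zero_add, add_zero, one_mul, mul_one]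
    ring

lemma crt_dvd (k o : ℕ) (hk : 1 ≤ k) : (X : ℤ⟦X⟧) ^ o ∣ crt k o := by
  unfold crt
  refine Dvd.dvd.mul_right (Dvd.dvd.mul_right (Dvd.dvd.mul_left (pow_dvd_pow _ ?_) _) _) _
  nlinarith

lemma cr_eq (k : ℕ) (hk : 1 ≤ k) :
    cr k + (if k = 1 then X else 0) = ssum (crt k) := by
  rw [cr, mgf_fiber]
  ext n
  rw [map_add, ssum, ssum, coeff_mk, coeff_mk, Finset.sum_range_succ', Finset.sum_range_succ',
    ← cr_term_zero k hk, map_add]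
  rw [Finset.sum_congr rfl fun o _ => by rw [cr_term k (o + 1) hk (by omega)]]
  ring

end Ospt

namespace Ospt

open PowerSeries Finset

lemma ssum_mod (τ : ℕ → ℤ⟦X⟧) (h : ∀ i, (X : ℤ⟦X⟧) ^ i ∣ τ i) (M : ℕ) :
    ∃ c, ssum τ = ∑ i ∈ Finset.range M, τ i + X ^ M * c := by
  obtain ⟨c, hc⟩ := ssum_spec τ h M
  exact ⟨c, by linear_combination hc⟩

noncomputable def lt (k i : ℕ) : ℤ⟦X⟧ := X ^ ((i + 1) * (k + i)) * Fi i * Fi (k + i)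
noncomputable def xt (k i : ℕ) : ℤ⟦X⟧ := X ^ (i * (k + i)) * Fi i * Fi (k + i)

lemma lt_dvd' (k i : ℕ) : (X : ℤ⟦X⟧) ^ (k + i) ∣ lt k i := by
  unfold lt
  refine Dvd.dvd.mul_right (Dvd.dvd.mul_right (pow_dvd_pow _ ?_) _) _
  nlinarith

lemma lt_dvd (k i : ℕ) : (X : ℤ⟦X⟧) ^ i ∣ lt k i :=
  (pow_dvd_pow _ (by omega)).trans (lt_dvd' k i)

lemma xt_dvd' (k i : ℕ) (hi : 1 ≤ i) : (X : ℤ⟦X⟧) ^ (k + i) ∣ xt k i := by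
  unfold xt
  refine Dvd.dvd.mul_right (Dvd.dvd.mul_right (pow_dvd_pow _ ?_) _) _
  nlinarith

lemma xt_dvd (k i : ℕ) : (X : ℤ⟦X⟧) ^ i ∣ xt k i := by
  rcases Nat.eq_zero_or_pos i with rfl | h
  · simp
  · exact (pow_dvd_pow _ (by omega)).trans (xt_dvd' k i h)

noncomputable def Lk (k : ℕ) : ℤ⟦X⟧ := ssum (lt k)
noncomputable def Dk (k : ℕ) : ℤ⟦X⟧ := ssum (xt k)

lemma tele1 (k M : ℕ) : ∑ i ∈ Finset.range M, crt k i =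
    ∑ i ∈ Finset.range M, lt k i - ∑ i ∈ Finset.range M, lt (k + 1) i + lt k M * (1 - X ^ M) := by
  induction M with
  | zero => simp
  | succ i ih =>
    rw [Finset.sum_range_succ, Finset.sum_range_succ, Finset.sum_range_succ, ih]
    have h1 := Fi_succ i
    have h2 := Fi_succ (k + i)
    have e1 : lt k (i + 1) * (1 - X ^ (i + 1)) =
        X ^ ((i + 1) * (k + i)) * X ^ (i + 1) * X ^ (k + i + 1) * Fi i * Fi (k + i + 1) := by
      rw [lt, ← h1, show k + (i + 1) = k + i + 1 by ring]; ring
    have e2 : lt (k + 1) i = X ^ ((i + 1) * (k + i)) * X ^ (i + 1) * Fi i * Fi (k + i + 1) := by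
      rw [lt, show k + 1 + i = k + i + 1 by ring]; ring
    have e3 : lt k i = X ^ ((i + 1) * (k + i)) * Fi i * ((1 - X ^ (k + i + 1)) * Fi (k + i + 1)) := by
      rw [lt, h2]
    have e4 : crt k i = (1 - X) * X ^ i * lt k i := by rw [crt, lt]; ring
    rw [e1, e2, e4, e3]
    ring

lemma cr_eq_Lk (k : ℕ) : ssum (crt k) = Lk k - Lk (k + 1) := by
  symm
  refine eq_ssum _ _ (fun M => ?_) (fun i => ?_)
  · obtain ⟨a, ha⟩ := ssum_mod _ (lt_dvd k) M
    obtain ⟨b, hb⟩ := ssum_mod _ (lt_dvd (k + 1)) M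
    obtain ⟨c, hc⟩ := lt_dvd k M
    rw [tele1, Lk, Lk, ha, hb, hc]
    exact ⟨a - b - c * (1 - X ^ M), by ring⟩
  · have e4 : crt k i = (1 - X) * X ^ i * lt k i := by rw [crt, lt]; ring
    rw [e4]
    exact Dvd.dvd.mul_left (lt_dvd k i) _

lemma tele2 (k M : ℕ) : ∑ i ∈ Finset.range (M + 1), lt k i + X ^ k * ∑ i ∈ Finset.range M, lt (k + 1) i
    = X ^ k * ∑ i ∈ Finset.range (M + 1), xt k i := by
  induction M with
  | zero => simp [lt, xt, mul_assoc]
  | succ i ih =>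
    rw [Finset.sum_range_succ _ (i + 1), Finset.sum_range_succ (lt (k + 1)) i,
      Finset.sum_range_succ _ (i + 1), mul_add, mul_add, ← ih]
    have h1 := Fi_succ i
    have e1 : lt k (i + 1) = X ^ k * X ^ (i + 1) * xt k (i + 1) := by rw [lt, xt]; ring
    have e2 : lt (k + 1) i = (1 - X ^ (i + 1)) * xt k (i + 1) := by
      rw [lt, xt, ← h1, show k + 1 + i = k + (i + 1) by ring]; ring
    rw [e1, e2]
    ring

lemma Lk_rec (k : ℕ) : Lk k + X ^ k * Lk (k + 1) = X ^ k * Dk k := by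
  apply eq_of_X_pow_dvd
  intro M
  obtain ⟨a, ha⟩ := ssum_mod _ (lt_dvd k) (M + 1)
  obtain ⟨b, hb⟩ := ssum_mod _ (lt_dvd (k + 1)) M
  obtain ⟨c, hc⟩ := ssum_mod _ (xt_dvd k) (M + 1)
  have := tele2 k M
  rw [Lk, Lk, Dk, ha, hb, hc]
  exact ⟨X * a + X ^ k * b - X ^ k * X * c, by linear_combination this⟩

lemma tele3 (k M : ℕ) : ∑ i ∈ Finset.range (M + 1), xt k i =
    ∑ i ∈ Finset.range (M + 1), xt (k + 1) i - lt (k + 1) M := by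
  induction M with
  | zero =>
    have := Fi_succ k
    simp only [zero_add, sum_range_one, xt, lt, Fi_zero, zero_mul, pow_zero, one_mul, add_zero]
    rw [← this]; ring
  | succ i ih =>
    rw [Finset.sum_range_succ, Finset.sum_range_succ _ (i + 1), ih]
    have h2 := Fi_succ (k + (i + 1))
    have h1 := Fi_succ i
    have e1 : lt (k + 1) i = (1 - X ^ (i + 1)) * xt k (i + 1) := by
      rw [lt, xt, ← h1, show k + 1 + i = k + (i + 1) by ring]; ring
    have e2 : xt k (i + 1) = X ^ ((i + 1) * (k + (i + 1))) * Fi (i + 1) *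
        ((1 - X ^ (k + (i + 1) + 1)) * Fi (k + (i + 1) + 1)) := by rw [h2, xt]
    rw [e1, e2, lt, xt, show k + 1 + (i + 1) = k + (i + 1) + 1 by ring]
    ring

lemma Dk_succ (k : ℕ) : Dk k = Dk (k + 1) := by
  apply eq_of_X_pow_dvd
  intro M
  obtain ⟨a, ha⟩ := ssum_mod _ (xt_dvd k) (M + 1)
  obtain ⟨c, hc⟩ := ssum_mod _ (xt_dvd (k + 1)) (M + 1)
  obtain ⟨b, hb⟩ := lt_dvd (k + 1) M
  have := tele3 k M
  rw [Dk, Dk, ha, hc, this, hb]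
  exact ⟨X * a - X * c - b, by ring⟩

noncomputable def Pp : ℤ⟦X⟧ := FB Set.univ
noncomputable def Qs : ℤ⟦X⟧ := DA Set.univ
noncomputable def Pb : ℤ⟦X⟧ := Qs * Pp

lemma Fi_mod (K : ℕ) : (X : ℤ⟦X⟧) ^ (K + 1) ∣ Pp - Fi K := by
  classical
  rw [PowerSeries.X_pow_dvd_iff]
  intro n hn
  rw [map_sub, sub_eq_zero, Pp, Fi, FB, FB, mgf, mgf, coeff_mk, coeff_mk]
  congr 2
  ext M
  simp only [Finset.mem_filter, Set.mem_univ, implies_true, and_true, Set.mem_Icc]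
  refine ⟨fun hM => ⟨hM, ?_⟩, fun h => h.1⟩
  rw [mem_PM] at hM
  intro i hi
  have := Multiset.single_le_sum (fun _ _ => Nat.zero_le _) i hi
  exact ⟨hM.1 i hi, by omega⟩

lemma Dk_mod (K : ℕ) : (X : ℤ⟦X⟧) ^ K ∣ Dk K - Fi K := by
  obtain ⟨a, ha⟩ := ssum_mod _ (xt_dvd K) (K + 1)
  rw [Dk, ha, Finset.sum_range_succ']
  have e : xt K 0 = Fi K := by simp [xt, Fi_zero]
  have : (X : ℤ⟦X⟧) ^ K ∣ ∑ i ∈ Finset.range K, xt K (i + 1) :=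
    Finset.dvd_sum fun i _ => (pow_dvd_pow _ (by omega)).trans (xt_dvd' K (i + 1) (by omega))
  obtain ⟨b, hb⟩ := this
  rw [hb, e]
  exact ⟨b + X * a, by ring⟩

lemma Dk_eq (k : ℕ) : Dk k = Pp := by
  have h : ∀ j, Dk (k + j) = Dk k := by
    intro j
    induction j with
    | zero => rfl
    | succ j ih => rw [← ih, ← add_assoc, ← Dk_succ]
  apply eq_of_X_pow_dvd
  intro M
  obtain ⟨a, ha⟩ := Dk_mod (k + M)
  obtain ⟨b, hb⟩ := Fi_mod (k + M)
  rw [h M] at ha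
  exact ⟨X ^ k * a - X ^ k * X * b, by linear_combination ha - hb⟩

noncomputable def Ck (k : ℕ) : ℤ⟦X⟧ := Qs * Lk k

lemma Ck_rec (k : ℕ) : Ck k = X ^ k * (Pb - Ck (k + 1)) := by
  have := Lk_rec k
  rw [Dk_eq] at this
  rw [Ck, Ck, Pb]
  linear_combination Qs * this

lemma cr_Ck (k : ℕ) (hk : 1 ≤ k) :
    Qs * cr k + (if k = 1 then X * Qs else 0) = Ck k - Ck (k + 1) := by
  have h1 := cr_eq k hk
  rw [cr_eq_Lk] at h1
  rw [Ck, Ck]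
  split_ifs at h1 ⊢ <;> linear_combination Qs * h1

lemma NN_Pp : NN Pp := NN_mgf _
lemma NN_Qs : NN Qs := NN_fgf _
lemma NN_Pb : NN Pb := NN_Qs.mul NN_Pp

end Ospt

namespace Ospt

open PowerSeries Finset

abbrev OPr := Finset ℕ × Multiset ℕ

def parts (x : OPr) : Multiset ℕ := x.1.val + x.2

def pos (x : OPr) : Prop := ∀ i ∈ parts x, 0 < i

lemma mem_parts {x : OPr} {i : ℕ} : i ∈ parts x ↔ i ∈ x.1 ∨ i ∈ x.2 := by
  simp [parts]

lemma val_sum (O : Finset ℕ) : O.val.sum = O.sum id := by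
  rw [Finset.sum, Multiset.map_id]

noncomputable def OP (n : ℕ) : Finset OPr :=
  (((Finset.range (n + 1)).biUnion DF) ×ˢ ((Finset.range (n + 1)).biUnion PM)).filter
    (fun x => (parts x).sum = n)

lemma mem_OP {n : ℕ} {x : OPr} : x ∈ OP n ↔ pos x ∧ (parts x).sum = n := by
  classical
  unfold OP
  simp only [Finset.mem_filter, Finset.mem_product, Finset.mem_biUnion, Finset.mem_range, mem_DF, mem_PM]
  constructor
  · rintro ⟨⟨⟨a, ha, h1, h2⟩, b, hb, h3, h4⟩, h⟩
    refine ⟨fun i hi => ?_, h⟩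
    rcases mem_parts.1 hi with hi | hi
    exacts [h1 i hi, h3 i hi]
  · rintro ⟨h1, h2⟩
    refine ⟨⟨⟨x.1.sum id, ?_, fun i hi => h1 i (mem_parts.2 (Or.inl hi)), rfl⟩,
      ⟨x.2.sum, ?_, fun i hi => h1 i (mem_parts.2 (Or.inr hi)), rfl⟩⟩, h2⟩
    all_goals rw [parts, Multiset.sum_add, val_sum] at h2; omega

open Classical in
noncomputable def ogf (p : OPr → Prop) : ℤ⟦X⟧ :=
  PowerSeries.mk fun n => (((OP n).filter p).card : ℤ)

lemma ogf_shift (p q : OPr → Prop) (c : ℕ) (f g : OPr → OPr)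
    (hf : ∀ M, pos M → p M → pos (f M) ∧ q (f M) ∧ (parts (f M)).sum = (parts M).sum + c ∧ g (f M) = M)
    (hg : ∀ M, pos M → q M → pos (g M) ∧ p (g M) ∧ (parts M).sum = (parts (g M)).sum + c ∧ f (g M) = M) :
    ogf q = X ^ c * ogf p := by
  classical
  ext n
  rw [coeff_X_pow_mul']
  simp only [ogf, coeff_mk]
  split_ifs with h
  · congr 1
    symm
    refine Finset.card_nbij' f g ?_ ?_ ?_ ?_
    · intro M hM
      simp only [Finset.coe_filter, Set.mem_ofPred_eq, mem_OP] at hM ⊢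
      obtain ⟨a, b, c', d⟩ := hf M hM.1.1 hM.2
      exact ⟨⟨a, by omega⟩, b⟩
    · intro M hM
      simp only [Finset.coe_filter, Set.mem_ofPred_eq, mem_OP] at hM ⊢
      obtain ⟨a, b, c', d⟩ := hg M hM.1.1 hM.2
      exact ⟨⟨a, by omega⟩, b⟩
    · intro M hM
      simp only [Finset.coe_filter, Set.mem_ofPred_eq, mem_OP] at hM
      exact (hf M hM.1.1 hM.2).2.2.2
    · intro M hM
      simp only [Finset.coe_filter, Set.mem_ofPred_eq, mem_OP] at hM
      exact (hg M hM.1.1 hM.2).2.2.2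
  · simp only [Nat.cast_eq_zero, Finset.card_eq_zero]
    apply Finset.filter_eq_empty_iff.2
    intro M hM hq
    rw [mem_OP] at hM
    have := (hg M hM.1 hq).2.2.1
    omega

lemma ogf_split (p r : OPr → Prop) :
    ogf p = ogf (fun M => p M ∧ r M) + ogf (fun M => p M ∧ ¬ r M) := by
  classical
  ext n
  simp only [ogf, coeff_mk, map_add]
  have h := (Finset.card_filter_add_card_filter_not (s := (OP n).filter p) r).symm
  rw [Finset.filter_filter, Finset.filter_filter] at h
  rw [← Nat.cast_add]
  norm_cast
  convert h using 3 <;> (ext; simp)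

lemma ogf_congr {p q : OPr → Prop} (h : ∀ M, pos M → (p M ↔ q M)) :
    ogf p = ogf q := by
  classical
  ext n
  simp only [ogf, coeff_mk]
  congr 2
  apply Finset.filter_congr
  intro M hM
  exact h M (mem_OP.1 hM).1

lemma ogf_prod (p : Multiset ℕ → Prop) : ogf (fun x => p x.2) = Qs * mgf p := by
  classical
  ext n
  rw [coeff_mul]
  simp only [Qs, DA, ogf, fgf, mgf, coeff_mk, Set.mem_univ, implies_true, Finset.filter_true]
  simp_rw [← Nat.cast_mul, ← Nat.cast_sum, ← Finset.card_product]
  rw [← Finset.card_sigma]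
  congr 1
  refine Finset.card_nbij'
    (fun x => ⟨(x.1.sum id, x.2.sum), x⟩) (fun x => x.2) ?_ ?_ ?_ ?_
  · rintro ⟨O, M⟩ hM
    simp only [Finset.coe_filter, Set.mem_ofPred_eq, mem_OP] at hM
    obtain ⟨⟨h1, h2⟩, h3⟩ := hM
    simp only [Finset.coe_sigma, Set.mem_sigma_iff, Finset.mem_coe, Finset.HasAntidiagonal.mem_antidiagonal,
      Finset.mem_product, Finset.mem_filter, mem_PM, mem_DF]
    refine ⟨?_, ⟨fun i hi => h1 i (mem_parts.2 (Or.inl hi)), by trivial⟩, ⟨fun i hi => h1 i (mem_parts.2 (Or.inr hi)), by trivial⟩, h3⟩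
    rw [← h2, parts, Multiset.sum_add, val_sum]
  · rintro ⟨⟨a, b⟩, ⟨O, M⟩⟩ hM
    simp only [Finset.coe_sigma, Set.mem_sigma_iff, Finset.mem_coe, Finset.HasAntidiagonal.mem_antidiagonal,
      Finset.mem_product, Finset.mem_filter, mem_PM, mem_DF] at hM
    obtain ⟨hab, ⟨h1, h2⟩, ⟨h5, h6⟩, h7⟩ := hM
    simp only [Finset.coe_filter, Set.mem_ofPred_eq, mem_OP]
    refine ⟨⟨?_, by rw [parts, Multiset.sum_add, val_sum, h2, h6, hab]⟩, h7⟩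
    intro i hi
    rcases mem_parts.1 hi with hi | hi
    exacts [h1 i hi, h5 i hi]
  · intro M _
    rfl
  · rintro ⟨⟨a, b⟩, ⟨O, M⟩⟩ hM
    simp only [Finset.coe_sigma, Set.mem_sigma_iff, Finset.mem_coe, Finset.HasAntidiagonal.mem_antidiagonal,
      Finset.mem_product, Finset.mem_filter, mem_PM, mem_DF] at hM
    obtain ⟨hab, ⟨h1, h2⟩, ⟨h5, h6⟩, h7⟩ := hM
    simp only [h2, h6]

lemma ogf_true : ogf (fun _ => True) = Pb := by
  rw [ogf_prod (fun _ => True), Pb, Pp, FB]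
  congr 1
  exact mgf_congr fun M _ => by simp

lemma card_over (n : ℕ) (p : OPr → Prop) :
    ((Nat.card {x : Overpartition n // p (x.overlined, x.nonoverlined)} : ℕ) : ℤ) = coeff n (ogf p) := by
  classical
  simp only [ogf, coeff_mk]
  congr 1
  rw [← Nat.card_eq_finsetCard]
  refine Nat.card_congr
    { toFun := fun x => ⟨(x.1.overlined, x.1.nonoverlined), ?_⟩
      invFun := fun y => ⟨⟨y.1.1, y.1.2, ?_, ?_, ?_⟩, ?_⟩
      left_inv := ?_
      right_inv := ?_ }
  · rw [Finset.mem_filter, mem_OP]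
    refine ⟨⟨fun i hi => ?_, ?_⟩, x.2⟩
    · rcases mem_parts.1 hi with hi | hi
      exacts [x.1.overlined_pos i hi, x.1.nonoverlined_pos i hi]
    · rw [parts, Multiset.sum_add, val_sum]; exact x.1.total
  · intro i hi
    exact (mem_OP.1 (Finset.mem_filter.1 y.2).1).1 i (mem_parts.2 (Or.inl hi))
  · intro i hi
    exact (mem_OP.1 (Finset.mem_filter.1 y.2).1).1 i (mem_parts.2 (Or.inr hi))
  · have := (mem_OP.1 (Finset.mem_filter.1 y.2).1).2
    rwa [parts, Multiset.sum_add, val_sum] at this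
  · exact (Finset.mem_filter.1 y.2).2
  · intro x; rfl
  · intro y; rfl

lemma Mbar_eq (k n : ℕ) : (Mbar (k : ℤ) n : ℤ) = coeff n (Qs * cr k) := by
  rw [cr, ← ogf_prod, ← card_over]
  rfl

def rk (x : OPr) : ℤ := ((parts x).sup : ℤ) - ((parts x).card : ℤ)

lemma Nbar_eq (k : ℤ) (n : ℕ) : (Nbar k n : ℤ) = coeff n (ogf (fun x => rk x = k)) := by
  rw [← card_over]
  rfl

lemma sup_mem (M : Multiset ℕ) (h : M ≠ 0) : M.sup ∈ M := by
  induction M using Multiset.induction_on with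
  | empty => simp at h
  | cons a M ih =>
    rw [Multiset.sup_cons]
    by_cases h : M = 0
    · subst h; simp
    · rcases le_total a M.sup with h' | h'
      · rw [sup_eq_right.2 h']; exact Multiset.mem_cons_of_mem (ih h)
      · rw [sup_eq_left.2 h']; exact Multiset.mem_cons_self _ _

lemma sup_eq {M : Multiset ℕ} {g : ℕ} (h1 : g ∈ M) (h2 : ∀ i ∈ M, i ≤ g) : M.sup = g :=
  le_antisymm (Multiset.sup_le.2 h2) (Multiset.le_sup h1)

lemma parts_ne {x : OPr} {k : ℕ} (hk : 1 ≤ k) (h : (k : ℤ) ≤ rk x) : parts x ≠ 0 := by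
  intro h0
  rw [rk, h0] at h
  simp at h
  omega

noncomputable def Tk (k : ℕ) : ℤ⟦X⟧ := ogf (fun x => (k : ℤ) ≤ rk x)
noncomputable def Xk (k : ℕ) : ℤ⟦X⟧ := ogf (fun x => (k : ℤ) ≤ rk x ∧ ¬ (parts x).sup ∈ x.1)

lemma toggle (k : ℕ) (hk : 1 ≤ k) :
    ogf (fun x => (k : ℤ) ≤ rk x ∧ (parts x).sup ∈ x.1) = Xk k := by
  classical
  symm
  have := ogf_shift (fun x => (k : ℤ) ≤ rk x ∧ (parts x).sup ∈ x.1)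
    (fun x => (k : ℤ) ≤ rk x ∧ ¬ (parts x).sup ∈ x.1) 0
    (fun x => (x.1.erase (parts x).sup, (parts x).sup ::ₘ x.2))
    (fun x => (insert (parts x).sup x.1, x.2.erase (parts x).sup)) ?_ ?_
  · rw [Xk, this, pow_zero, one_mul]
  · rintro ⟨O, M⟩ hp ⟨h1, h2⟩
    have e : parts (O.erase (parts (O, M)).sup, (parts (O, M)).sup ::ₘ M) = parts (O, M) := by
      generalize (parts (O, M)).sup = s at h2 ⊢
      simp only [parts, Finset.erase_val] at h2 ⊢
      rw [Multiset.add_cons, ← Multiset.cons_add, Multiset.cons_erase]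
      exact h2
    dsimp only at h2 ⊢
    simp only [pos, rk, e]
    refine ⟨hp, ⟨h1, by simp⟩, rfl, ?_⟩
    rw [Finset.insert_erase h2, Multiset.erase_cons_head]
  · rintro ⟨O, M⟩ hp ⟨h1, h2⟩
    have h3 : (parts (O, M)).sup ∈ M := by
      have := sup_mem _ (parts_ne hk h1)
      exact (mem_parts.1 this).resolve_left h2
    have e : parts (insert (parts (O, M)).sup O, M.erase (parts (O, M)).sup) = parts (O, M) := by
      generalize (parts (O, M)).sup = s at h2 h3 ⊢
      simp only [parts] at h2 ⊢
      rw [Finset.insert_val_of_notMem h2, Multiset.cons_add, ← Multiset.add_cons, Multiset.cons_erase h3]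
    dsimp only at h2 ⊢
    simp only [pos, rk, e]
    refine ⟨hp, ⟨h1, by simp⟩, rfl, ?_⟩
    rw [Finset.erase_insert h2, Multiset.cons_erase h3]

lemma Tk_eq (k : ℕ) (hk : 1 ≤ k) : Tk k = 2 * Xk k := by
  have h := ogf_split (fun x => (k : ℤ) ≤ rk x) (fun x => (parts x).sup ∈ x.1)
  rw [toggle k hk] at h
  rw [Tk, h]
  change Xk k + Xk k = _
  ring

def Yp (k : ℕ) (x : OPr) : Prop :=
  (∀ i ∈ x.1, i ≤ (parts x).card + k + 1) ∧ (∀ i ∈ x.2, i ≤ (parts x).card + k + 2)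

lemma Y_compl (k : ℕ) : Pb = ogf (Yp k) + (Xk (k + 2) + Xk (k + 3)) := by
  have h1 := ogf_split (fun _ => True) (Yp k)
  have h2 := ogf_split (fun x => True ∧ ¬ Yp k x) (fun x => (parts x).sup ∈ x.1)
  rw [ogf_true] at h1
  have e1 : ogf (fun x => True ∧ Yp k x) = ogf (Yp k) := ogf_congr fun _ _ => by simp
  have e2 : ogf (fun x => (True ∧ ¬ Yp k x) ∧ (parts x).sup ∈ x.1) = Xk (k + 2) := by
    rw [← toggle _ (by omega)]
    refine ogf_congr fun x hx => ?_
    refine and_congr_left fun hs => ?_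
    simp only [true_and, Yp, rk]
    constructor
    · intro h
      by_contra h'
      apply h
      refine ⟨fun i hi => ?_, fun i hi => ?_⟩
      · have := Multiset.le_sup (mem_parts.2 (Or.inl hi) : i ∈ parts x); push_cast at h'; omega
      · have := Multiset.le_sup (mem_parts.2 (Or.inr hi) : i ∈ parts x); push_cast at h'; omega
    · rintro h ⟨h3, h4⟩
      have := h3 _ hs
      push_cast at h; omega
  have e3 : ogf (fun x => (True ∧ ¬ Yp k x) ∧ ¬ (parts x).sup ∈ x.1) = Xk (k + 3) := by
    refine ogf_congr fun x hx => ?_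
    refine and_congr_left fun hs => ?_
    simp only [true_and, Yp, rk]
    constructor
    · intro h
      by_contra h'
      apply h
      push_cast at h'
      refine ⟨fun i hi => ?_, fun i hi => ?_⟩
      · have := Multiset.le_sup (mem_parts.2 (Or.inl hi) : i ∈ parts x)
        have : i ≠ (parts x).sup := by rintro rfl; exact hs hi
        omega
      · have := Multiset.le_sup (mem_parts.2 (Or.inr hi) : i ∈ parts x); omega
    · rintro h ⟨h3, h4⟩
      have h0 := parts_ne (x := x) (k := k + 3) (by omega) h
      have := h4 _ ((mem_parts.1 (sup_mem _ h0)).resolve_left hs)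
      push_cast at h; omega
  rw [e2, e3] at h2
  rw [e1, h2] at h1
  exact h1

end Ospt

namespace Ospt

open PowerSeries Finset

def up (O : Finset ℕ) : Finset ℕ := O.map (addRightEmbedding 1)
def Aup (b : Bool) (O : Finset ℕ) : Finset ℕ := if b then insert 1 (up O) else up O
def dn (O : Finset ℕ) : Finset ℕ := (O.erase 1).image (· - 1)
def upM (M : Multiset ℕ) (r : ℕ) : Multiset ℕ := M.map (· + 1) + Multiset.replicate r 1
def dnM (M : Multiset ℕ) : Multiset ℕ := (M.filter (fun i => i ≠ 1)).map (· - 1)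

lemma mem_up {O : Finset ℕ} {i : ℕ} : i ∈ up O ↔ ∃ j ∈ O, j + 1 = i := by
  simp [up]

lemma one_notMem_up {O : Finset ℕ} (h : ∀ i ∈ O, 0 < i) : 1 ∉ up O := by
  rw [mem_up]
  rintro ⟨j, hj, h1⟩
  have := h j hj
  omega

lemma mem_Aup {b : Bool} {O : Finset ℕ} {i : ℕ} : i ∈ Aup b O ↔ (b = true ∧ i = 1) ∨ ∃ j ∈ O, j + 1 = i := by
  cases b <;> simp [Aup, mem_up]

lemma one_mem_Aup {b : Bool} {O : Finset ℕ} (h : ∀ i ∈ O, 0 < i) : 1 ∈ Aup b O ↔ b = true := by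
  have := one_notMem_up h
  cases b <;> simp [Aup, this]

lemma dn_Aup {b : Bool} {O : Finset ℕ} (h : ∀ i ∈ O, 0 < i) : dn (Aup b O) = O := by
  ext i
  simp only [dn, Finset.mem_image, Finset.mem_erase, mem_Aup]
  constructor
  · rintro ⟨j, ⟨h1, h2⟩, rfl⟩
    rcases h2 with ⟨_, h2⟩ | ⟨m, hm, rfl⟩
    · omega
    · simpa using hm
  · intro hi
    have := h i hi
    exact ⟨i + 1, ⟨by omega, Or.inr ⟨i, hi, rfl⟩⟩, by omega⟩

lemma dnM_upM {M : Multiset ℕ} {r : ℕ} (h : ∀ i ∈ M, 0 < i) : dnM (upM M r) = M := by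
  rw [dnM, upM, Multiset.filter_add, Multiset.filter_eq_self.2, Multiset.filter_eq_nil.2, add_zero,
    Multiset.map_map]
  · simp
  · intro i hi; simp [Multiset.eq_of_mem_replicate hi]
  · intro i hi
    obtain ⟨j, hj, rfl⟩ := Multiset.mem_map.1 hi
    have := h j hj
    omega

lemma decomp (x : OPr) (hx : pos x) (b : Bool) (hb : 1 ∈ x.1 ↔ b = true) :
    ∃ O M r, (∀ i ∈ O, 0 < i) ∧ (∀ i ∈ M, 0 < i) ∧ x = (Aup b O, upM M r) := by
  have p1 : ∀ i ∈ x.1, 0 < i := fun i hi => hx i (mem_parts.2 (Or.inl hi))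
  have p2 : ∀ i ∈ x.2, 0 < i := fun i hi => hx i (mem_parts.2 (Or.inr hi))
  refine ⟨dn x.1, dnM x.2, x.2.count 1, ?_, ?_, Prod.ext ?_ ?_⟩
  · intro i hi
    simp only [dn, Finset.mem_image, Finset.mem_erase] at hi
    obtain ⟨j, ⟨h1, h2⟩, rfl⟩ := hi
    have := p1 j h2; omega
  · intro i hi
    simp only [dnM, Multiset.mem_map, Multiset.mem_filter] at hi
    obtain ⟨j, ⟨h1, h2⟩, rfl⟩ := hi
    have := p2 j h1; omega
  · ext i
    simp only [mem_Aup, dn, Finset.mem_image, Finset.mem_erase, ← hb]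
    constructor
    · intro hi
      by_cases h1 : i = 1
      · subst h1; exact Or.inl ⟨hi, rfl⟩
      · have := p1 i hi
        exact Or.inr ⟨i - 1, ⟨i, ⟨h1, hi⟩, rfl⟩, by omega⟩
    · rintro (⟨h1, rfl⟩ | ⟨j, ⟨m, ⟨h1, h2⟩, rfl⟩, rfl⟩)
      · exact h1
      · have := p1 m h2
        rwa [show m - 1 + 1 = m by omega]
  · change x.2 = upM (dnM x.2) _
    rw [upM, dnM, ← Multiset.filter_eq' x.2 1, Multiset.map_map]
    have : (Multiset.filter (fun i => i ≠ 1) x.2).map ((fun x => x + 1) ∘ fun x => x - 1) =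
        Multiset.filter (fun i => i ≠ 1) x.2 := by
      conv_rhs => rw [← Multiset.map_id (Multiset.filter (fun i => i ≠ 1) x.2)]
      apply Multiset.map_congr rfl
      intro i hi
      have := p2 i (Multiset.mem_of_mem_filter hi)
      simp; omega
    rw [this, add_comm]
    exact (Multiset.filter_add_not (fun i => i = 1) x.2).symm

lemma parts_up {b : Bool} {O : Finset ℕ} (M : Multiset ℕ) (r : ℕ) (h : ∀ i ∈ O, 0 < i) :
    parts (Aup b O, upM M r) = (parts (O, M)).map (· + 1) + Multiset.replicate (r + b.toNat) 1 := by
  have e : (Aup b O).val = O.val.map (· + 1) + Multiset.replicate b.toNat 1 := by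
    cases b
    · simp [Aup, up]
    · simp only [Aup, if_true]
      rw [Finset.insert_val_of_notMem (one_notMem_up h)]
      simp [up]
      rw [← Multiset.singleton_add, add_comm]
  simp only [parts, e, upM, Multiset.map_add, Multiset.replicate_add]
  abel

lemma card_up {b : Bool} {O : Finset ℕ} (M : Multiset ℕ) (r : ℕ) (h : ∀ i ∈ O, 0 < i) :
    (parts (Aup b O, upM M r)).card = (parts (O, M)).card + r + b.toNat := by
  rw [parts_up M r h]; simp; ring

lemma sum_up {b : Bool} {O : Finset ℕ} (M : Multiset ℕ) (r : ℕ) (h : ∀ i ∈ O, 0 < i) :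
    (parts (Aup b O, upM M r)).sum = (parts (O, M)).sum + (parts (O, M)).card + r + b.toNat := by
  rw [parts_up M r h, Multiset.sum_add, Multiset.sum_map_add]; simp; ring

lemma pos_up {b : Bool} {O : Finset ℕ} (M : Multiset ℕ) (r : ℕ) (h : ∀ i ∈ O, 0 < i) :
    pos (Aup b O, upM M r) := by
  intro i hi
  rw [parts_up M r h, Multiset.mem_add] at hi
  rcases hi with hi | hi
  · obtain ⟨j, _, rfl⟩ := Multiset.mem_map.1 hi; omega
  · rw [Multiset.eq_of_mem_replicate hi]; exact one_pos

lemma parts_cons (O : Finset ℕ) (g : ℕ) (M : Multiset ℕ) : parts (O, g ::ₘ M) = g ::ₘ parts (O, M) := by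
  simp [parts]

lemma bij (k : ℕ) (hk : 1 ≤ k) (b : Bool) :
    Xk (k + b.toNat) = X ^ (k + 1) * ogf (fun x => Yp k x ∧ (1 ∈ x.1 ↔ b = true)) := by
  classical
  refine ogf_shift _ _ (k + 1)
    (fun x => (dn x.1, ((parts x).card + k + 1) ::ₘ dnM x.2))
    (fun x => (Aup b x.1, upM (x.2.erase (parts x).sup)
      ((parts x).sup - k - (parts x).card - b.toNat))) ?_ ?_
  · rintro x hx ⟨⟨hY1, hY2⟩, hb⟩
    obtain ⟨O, M, r, hO, hM, rfl⟩ := decomp x hx b hb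
    have hc := card_up (b := b) M r hO
    have hs := sum_up (b := b) M r hO
    simp only [dn_Aup hO, dnM_upM hM, parts_cons]
    simp only [hc] at hY1 hY2 ⊢
    set c := (parts (O, M)).card
    have b1 : ∀ i ∈ O, i ≤ c + r + b.toNat + k := fun i hi => by
      have := hY1 (i + 1) (mem_Aup.2 (Or.inr ⟨i, hi, rfl⟩)); omega
    have b2 : ∀ i ∈ M, i ≤ c + r + b.toNat + k + 1 := fun i hi => by
      have := hY2 (i + 1) (Multiset.mem_add.2 (Or.inl (Multiset.mem_map_of_mem _ hi))); omega
    have hsup : ((c + r + b.toNat + k + 1) ::ₘ parts (O, M)).sup = c + r + b.toNat + k + 1 := by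
      refine sup_eq (Multiset.mem_cons_self _ _) fun i hi => ?_
      rcases Multiset.mem_cons.1 hi with rfl | hi
      · rfl
      · rcases mem_parts.1 hi with hi | hi
        · have := b1 i hi; omega
        · exact b2 i hi
    refine ⟨?_, ⟨?_, ?_⟩, ?_, ?_⟩
    · intro i hi
      rw [parts_cons] at hi
      rcases Multiset.mem_cons.1 hi with rfl | hi
      · omega
      · rcases mem_parts.1 hi with hi | hi
        exacts [hO i hi, hM i hi]
    · rw [rk, parts_cons, hsup, Multiset.card_cons]; push_cast; omega
    · rw [hsup]; intro h; have := b1 _ h; omega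
    · rw [Multiset.sum_cons, hs]; omega
    · rw [hsup, Multiset.erase_cons_head, Multiset.card_cons]
      congr 2
      omega
  · rintro ⟨O, M⟩ hx ⟨h1, h2⟩
    have hne := parts_ne (by omega) h1
    have hgM : (parts (O, M)).sup ∈ M := (mem_parts.1 (sup_mem _ hne)).resolve_left h2
    have hle : ∀ i ∈ parts (O, M), i ≤ (parts (O, M)).sup := fun i hi => Multiset.le_sup hi
    rw [rk] at h1
    generalize (parts (O, M)).sup = g at *
    obtain ⟨M, rfl⟩ := Multiset.exists_cons_of_mem hgM
    dsimp only at h2 ⊢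
    simp only [parts_cons, Multiset.card_cons, Multiset.erase_cons_head, Multiset.sum_cons] at *
    have hO : ∀ i ∈ O, 0 < i := fun i hi => hx i (mem_parts.2 (Or.inl hi))
    have hM : ∀ i ∈ M, 0 < i := fun i hi => hx i (mem_parts.2 (Or.inr (Multiset.mem_cons_of_mem hi)))
    have lO : ∀ i ∈ O, i < g := fun i hi => by
      have a1 := hle i (Multiset.mem_cons_of_mem (mem_parts.2 (Or.inl hi)))
      have : i ≠ g := by rintro rfl; exact h2 hi
      omega
    have lM : ∀ i ∈ M, i ≤ g := fun i hi =>
      hle i (Multiset.mem_cons_of_mem (mem_parts.2 (Or.inr hi)))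
    set c := (parts (O, M)).card with hcdef
    push_cast at h1
    have hr : ∃ r, g = c + 1 + k + b.toNat + r := ⟨g - (c + 1 + k + b.toNat), by omega⟩
    obtain ⟨r, hr⟩ := hr
    have er : g - k - (c + 1) - b.toNat = r := by omega
    simp only [er]
    have hc := card_up (b := b) M r hO
    have hs := sum_up (b := b) M r hO
    refine ⟨pos_up M r hO, ⟨⟨?_, ?_⟩, one_mem_Aup hO⟩, ?_, ?_⟩
    · intro i hi
      rw [hc]
      rcases mem_Aup.1 hi with ⟨_, rfl⟩ | ⟨j, hj, rfl⟩
      · omega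
      · have := lO j hj; omega
    · intro i hi
      rw [hc]
      rcases Multiset.mem_add.1 hi with hi | hi
      · obtain ⟨j, hj, rfl⟩ := Multiset.mem_map.1 hi
        have := lM j hj; omega
      · rw [Multiset.eq_of_mem_replicate hi]; omega
    · rw [hs]; omega
    · rw [dn_Aup hO, dnM_upM hM, hc]
      congr 2
      omega

noncomputable def Ak (k : ℕ) : ℤ⟦X⟧ := Tk k + Tk (k + 1)

lemma Ak_rec (k : ℕ) (hk : 1 ≤ k) : Ak k = X ^ (k + 1) * (2 * Pb - Ak (k + 2)) := by
  have h1 := bij k hk false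
  have h2 := bij k hk true
  have h3 := ogf_split (Yp k) (fun x => 1 ∈ x.1)
  have h4 := Y_compl k
  simp only [Bool.toNat_false, Bool.toNat_true, add_zero, iff_true, Bool.false_eq_true, iff_false] at h1 h2
  rw [Ak, Ak, Tk_eq k hk, Tk_eq (k + 1) (by omega), Tk_eq (k + 2) (by omega), Tk_eq (k + 2 + 1) (by omega), h4, h1, h2, h3]
  ring

end Ospt

namespace Ospt

open PowerSeries Finset

noncomputable def Gs (S : Set ℕ) : ℤ⟦X⟧ := DA Sᶜ * Pp

lemma Gs_empty : Gs ∅ = Pb := by rw [Gs, Set.compl_empty, Pb, Qs]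

lemma Gs_insert {b : ℕ} {S : Set ℕ} (hb : 0 < b) (h : b ∉ S) : Gs S = (1 + X ^ b) * Gs (insert b S) := by
  rw [Gs, Gs, DA_remove hb (B := Sᶜ) h]
  have : Sᶜ \ {b} = (insert b S)ᶜ := by
    ext x; simp only [Set.mem_sdiff, Set.mem_compl_iff, Set.mem_singleton_iff, Set.mem_insert_iff]; tauto
  rw [this]; ring

lemma NN_Gs1 (S : Set ℕ) (x : ℕ) (hx : 0 < x) : NN (Gs S * (1 - X ^ x)) := by
  have : Gs S * (1 - X ^ x) = DA Sᶜ * FB (Set.univ \ {x}) := by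
    rw [← FB_remove hx (Set.mem_univ x), Gs, Pp]; ring
  rw [this]
  exact (NN_fgf _).mul (NN_mgf _)

lemma NN_Gs2 (S : Set ℕ) (x y : ℕ) (hx : 0 < x) (hy : 0 < y) (h : x ≠ y) :
    NN (Gs S * ((1 - X ^ x) * (1 - X ^ y))) := by
  have : Gs S * ((1 - X ^ x) * (1 - X ^ y)) = DA Sᶜ * FB ((Set.univ \ {x}) \ {y}) := by
    rw [← FB_remove hy (by simp [h.symm]), ← FB_remove hx (Set.mem_univ x), Gs, Pp]; ring
  rw [this]
  exact (NN_fgf _).mul (NN_mgf _)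

lemma NN_Gs (S : Set ℕ) : NN (Gs S) := (NN_fgf _).mul NN_Pp

lemma one_add_ne_zero (k : ℕ) : (1 + X ^ k : ℤ⟦X⟧) ≠ 0 := by
  intro h
  have := congrArg (coeff 0) h
  rcases Nat.eq_zero_or_pos k with rfl | hk
  · simp at this
  · simp [coeff_X_pow, hk.ne'] at this

noncomputable def Zb (b : ℕ) : ℤ⟦X⟧ := Ck b - X ^ b * Gs {b}

lemma Pb_one (b : ℕ) (hb : 0 < b) : Pb = (1 + X ^ b) * Gs {b} := by
  rw [← Gs_empty, Gs_insert hb (Set.notMem_empty b), LawfulSingleton.insert_empty_eq]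

lemma Zb_rec (b : ℕ) (hb : 0 < b) :
    Zb b = X ^ (2 * b) * (Gs {b, b + 1, b + 2} * ((1 - X ^ 1) * (1 - X ^ (2 * b + 2)))) + X ^ (2 * b + 1) * Zb (b + 2) := by
  have h0 := Pb_one b hb
  have h2 := Pb_one (b + 2) (by omega)
  have h1 : Pb = (1 + X ^ b) * ((1 + X ^ (b + 1)) * ((1 + X ^ (b + 2)) * Gs {b, b + 1, b + 2})) := by
    rw [Pb_one (b + 2) (by omega), Gs_insert (b := b + 1) (by omega) (by simp),
      Gs_insert (b := b) (by omega) (by simp)]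
    ring
  have c1 := Ck_rec b
  have c2 := Ck_rec (b + 1)
  apply mul_left_cancel₀ (one_add_ne_zero b)
  apply mul_left_cancel₀ (one_add_ne_zero (b + 1))
  apply mul_left_cancel₀ (one_add_ne_zero (b + 2))
  rw [show b + 1 + 1 = b + 2 from rfl] at c2
  rw [Zb, Zb, c1, c2]
  linear_combination (X ^ (2 * b) * (1 - X ^ 1) * (1 - X ^ (2 * b + 2))) * h1 + (1 + X ^ (b + 1)) * (1 + X ^ (b + 2)) * X ^ b * h0 - X ^ (2 * b + 1) * (1 + X ^ b) * (1 + X ^ (b + 1)) * X ^ (b + 2) * h2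

lemma NN_Zb (b : ℕ) (hb : 0 < b) : NN (Zb b) := by
  intro n
  induction n using Nat.strong_induction_on generalizing b with
  | _ n ih =>
    rw [Zb_rec b hb, map_add]
    refine add_nonneg (((NN_X_pow _).mul (NN_Gs2 _ _ _ (by omega) (by omega) (by omega))) n) ?_
    rw [coeff_X_pow_mul']
    split_ifs with h
    · exact ih _ (by omega) (b + 2) (by omega)
    · exact le_rfl

lemma Ck_le (a : ℕ) : X ^ a * Gs {a + 1} - Ck a = X ^ a * Zb (a + 1) := by
  have := Pb_one (a + 1) (by omega)
  rw [Zb, Ck_rec a]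
  linear_combination (-X ^ a) * this

noncomputable def geo (n : ℕ) : ℤ⟦X⟧ := FB {n}

lemma geo_eq (n : ℕ) (hn : 0 < n) : (1 - X ^ n) * geo n = 1 := by
  have := FB_insert hn (B := ∅) (Set.notMem_empty n)
  rw [LawfulSingleton.insert_empty_eq] at this
  rw [geo, this, ← Fi_zero, Fi]
  congr 1
  ext x; simp

noncomputable def Row (l j : ℕ) : ℤ⟦X⟧ :=
  Pb * ((1 - X ^ (2 * l + 1)) * geo (2 * (2 * l + 1))) - Ck (3 * l + 1 + j)
    - X ^ (3 * l + 1 + j + (2 * l + 1) + 1) * Pb * ((1 - X ^ (l + 1)) ^ 2 * geo (4 * (l + 1)))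

lemma Row_pos (l j : ℕ) (hl : 1 ≤ l) (hj : 1 ≤ j) : NN (Row l j) := by
  have hz : NN (Zb (3 * l + 1 + j + 1)) := NN_Zb _ (by omega)
  have hc := Ck_le (3 * l + 1 + j)
  have hG0 := NN_Gs1 {2 * l + 1, l + 1, 2 * l + 2, 3 * l + 1 + j + 1}
  have hG := NN_Gs2 {2 * l + 1, l + 1, 2 * l + 2, 3 * l + 1 + j + 1}
  have e1 : Gs {3 * l + 1 + j + 1} = (1 + X ^ (2 * l + 1)) * ((1 + X ^ (l + 1)) * ((1 + X ^ (2 * l + 2)) *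
      Gs {2 * l + 1, l + 1, 2 * l + 2, 3 * l + 1 + j + 1})) := by
    rw [Gs_insert (b := 2 * l + 2) (S := {3 * l + 1 + j + 1}) (by omega) (by simp; omega),
      Gs_insert (b := l + 1) (S := {2 * l + 2, 3 * l + 1 + j + 1}) (by omega) (by simp; omega),
      Gs_insert (b := 2 * l + 1) (S := {l + 1, 2 * l + 2, 3 * l + 1 + j + 1}) (by omega) (by simp; omega)]
    ring
  have e2 := Pb_one (3 * l + 1 + j + 1) (by omega)
  generalize Gs {2 * l + 1, l + 1, 2 * l + 2, 3 * l + 1 + j + 1} = G at *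
  have g1 := geo_eq (2 * (2 * l + 1)) (by omega)
  have g2 := geo_eq (4 * (l + 1)) (by omega)
  rw [e1] at e2 hc
  have key : Row l j =
     (1 + X ^ (l + 1)) * (1 + X ^ (2 * l + 2)) * (X ^ (3 * l + 1 + j + 1) * (G * (1 - X ^ (2 * l)))) +
     ((G * ((1 - X ^ (l + 1)) * (1 - X ^ (5 * l + j + 3))) + X ^ (l + 1) * (G * (1 - X ^ (2 * l + j)))) +
      X ^ (l + 1) * (G * ((1 - X ^ (l + 1)) * (1 - X ^ (6 * l + j + 3))) + X ^ (l + 1) * (G * (1 - X ^ (2 * l + j)))) +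
      X ^ (2 * l + 2) * (G * ((1 - X ^ (l + 1)) * (1 - X ^ (6 * l + 2 * j + 3))) + X ^ (l + 1) * (G * (1 - X ^ (2 * l + j)))) +
      X ^ (3 * l + 3) * (G * ((1 - X ^ (l + 1)) * (1 - X ^ (7 * l + 2 * j + 3))) + X ^ (l + 1) * (G * (1 - X ^ (2 * l + j))))) + X ^ (3 * l + 1 + j) * Zb (3 * l + 1 + j + 1) := by
    have r1 : Pb * ((1 - X ^ (2 * l + 1)) * geo (2 * (2 * l + 1))) =
        (1 + X ^ (3 * l + 1 + j + 1)) * ((1 + X ^ (l + 1)) * ((1 + X ^ (2 * l + 2)) * G)) := by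
      rw [e2]
      linear_combination ((1 + X ^ (3 * l + 1 + j + 1)) * ((1 + X ^ (l + 1)) * ((1 + X ^ (2 * l + 2)) * G))) * g1
    have r2 : Pb * ((1 - X ^ (l + 1)) ^ 2 * geo (4 * (l + 1))) =
        (1 + X ^ (3 * l + 1 + j + 1)) * ((1 + X ^ (2 * l + 1)) * ((1 - X ^ (l + 1)) * G)) := by
      rw [e2]
      linear_combination ((1 + X ^ (3 * l + 1 + j + 1)) * ((1 + X ^ (2 * l + 1)) * ((1 - X ^ (l + 1)) * G))) * g2
    rw [Row, r1, mul_assoc (X ^ (3 * l + 1 + j + (2 * l + 1) + 1)), r2]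
    linear_combination hc
  rw [key]
  have n1 : NN (1 + X ^ (l + 1) : ℤ⟦X⟧) := NN_one.add (NN_X_pow _)
  have n2 : NN (1 + X ^ (2 * l + 2) : ℤ⟦X⟧) := NN_one.add (NN_X_pow _)
  have n3 : NN (X ^ (l + 1) * (G * (1 - X ^ (2 * l + j)))) := (NN_X_pow _).mul (hG0 _ (by omega))
  refine ((((n1.mul n2).mul ((NN_X_pow _).mul (hG0 _ (by omega))))).add ?_).add ((NN_X_pow _).mul hz)
  refine ((NN.add (NN.add ?_ n3) ?_).add ?_).add ?_
  · exact hG _ _ (by omega) (by omega) (by omega)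
  · exact (NN_X_pow _).mul ((hG _ _ (by omega) (by omega) (by omega)).add n3)
  · exact (NN_X_pow _).mul ((hG _ _ (by omega) (by omega) (by omega)).add n3)
  · exact (NN_X_pow _).mul ((hG _ _ (by omega) (by omega) (by omega)).add n3)

lemma Row_zero_eq (j : ℕ) (hj : 1 ≤ j) : Row 0 j =
    Gs {1, 2, j + 2} * ((1 - X ^ (j + 1)) * (1 + X ^ 2) - X ^ (j + 3) * (1 - X ^ 1) * (1 + X ^ (j + 2)))
      + X ^ (j + 1) * Zb (j + 2) := by
  have hc := Ck_le (j + 1)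
  have e1 : Gs {j + 2} = (1 + X ^ 1) * ((1 + X ^ 2) * Gs {1, 2, j + 2}) := by
    rw [Gs_insert (b := 2) (S := {j + 2}) (by omega) (by simp; omega),
      Gs_insert (b := 1) (S := {2, j + 2}) (by omega) (by simp)]
    ring
  have e2 := Pb_one (j + 2) (by omega)
  generalize Gs {1, 2, j + 2} = G at *
  have g1 := geo_eq 2 (by omega)
  have g2 := geo_eq 4 (by omega)
  rw [show j + 1 + 1 = j + 2 by ring] at hc
  rw [e1] at e2 hc
  have r1 : Pb * ((1 - X ^ 1) * geo 2) = (1 + X ^ (j + 2)) * ((1 + X ^ 2) * G) := by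
    rw [e2]
    linear_combination ((1 + X ^ (j + 2)) * ((1 + X ^ 2) * G)) * g1
  have r2 : Pb * ((1 - X ^ 1) ^ 2 * geo 4) = (1 + X ^ (j + 2)) * ((1 - X ^ 1) * G) := by
    rw [e2]
    linear_combination ((1 + X ^ (j + 2)) * ((1 - X ^ 1) * G)) * g2
  rw [Row]
  rw [show 3 * 0 + 1 + j + (2 * 0 + 1) + 1 = j + 3 by ring, show 3 * 0 + 1 + j = j + 1 by ring,
    show 2 * 0 + 1 = 1 by rfl, show 2 * 1 = 2 by rfl, show 4 * 1 = 4 by rfl]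
  rw [r1, mul_assoc (X ^ (j + 3)), r2]
  linear_combination hc

lemma Row_zero_pos (j : ℕ) (hj : 1 ≤ j) : NN (Row 0 j) := by
  rw [Row_zero_eq j hj]
  have hG0 := NN_Gs1 {1, 2, j + 2}
  have hG := NN_Gs2 {1, 2, j + 2}
  generalize Gs {1, 2, j + 2} = G at *
  obtain ⟨i, rfl⟩ := Nat.exists_eq_add_of_le hj
  have e : G * ((1 - X ^ (1 + i + 1)) * (1 + X ^ 2) - X ^ (1 + i + 3) * (1 - X ^ 1) * (1 + X ^ (1 + i + 2))) =
    (G * ((1 - X ^ 1) * (1 - X ^ (i + 4))) + X ^ 1 * (G * (1 - X ^ (i + 1)))) +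
     X ^ 2 * (G * ((1 - X ^ 1) * (1 - X ^ (2 * i + 5))) + X ^ 1 * (G * (1 - X ^ (i + 1)))) := by ring
  rw [e]
  have n3 : NN (X ^ 1 * (G * (1 - X ^ (i + 1)))) := (NN_X_pow _).mul (hG0 _ (by omega))
  refine NN.add (NN.add (NN.add ?_ n3) ?_) ((NN_X_pow _).mul (NN_Zb _ (by omega)))
  · exact hG _ _ (by omega) (by omega) (by omega)
  · exact (NN_X_pow _).mul ((hG _ _ (by omega) (by omega) (by omega)).add n3)

/-- strictness at `j = 1` -/
lemma Row_one : NN (Row 0 1 - X ^ 2 * (Qs * FB {n | 4 ≤ n})) := by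
  rw [Row_zero_eq 1 le_rfl]
  have hG0 := NN_Gs1 {1, 2, 1 + 2}
  have hG := NN_Gs2 {1, 2, 1 + 2}
  have e1 : Pb = (1 + X ^ 1) * ((1 + X ^ 2) * ((1 + X ^ 3) * Gs {1, 2, 1 + 2})) := by
    rw [Pb_one 3 (by omega), Gs_insert (b := 2) (S := {3}) (by omega) (by simp),
      Gs_insert (b := 1) (S := {2, 3}) (by omega) (by simp)]
    ring
  have e2 : (1 - X ^ 3) * ((1 - X ^ 2) * ((1 - X ^ 1) * Pp)) = FB {n | 4 ≤ n} := by
    rw [Pp, FB_remove (by omega) (Set.mem_univ _), FB_remove (by omega) (by simp),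
      FB_remove (by omega) (by simp)]
    apply mgf_congr
    intro M hM
    refine forall₂_congr fun i hi => ?_
    have := hM i hi
    simp only [Set.mem_sdiff, Set.mem_univ, true_and, Set.mem_singleton_iff, Set.mem_ofPred_eq]
    omega
  generalize Gs {1, 2, 1 + 2} = G at *
  have g4 := geo_eq 4 (by omega)
  have g6 := geo_eq 6 (by omega)
  have e3 : G * (1 - X ^ 2) = Qs * FB {n | 4 ≤ n} * (geo 4 * geo 6) := by
    rw [← e2]
    rw [Pb] at e1
    linear_combination (-(1 - X ^ 3) * (1 - X ^ 2) * (1 - X ^ 1) * (geo 4 * geo 6)) * e1 -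
      (G * (1 - X ^ 2)) * g4 - (G * (1 - X ^ 2) * (1 - X ^ 4) * geo 4) * g6
  have e4 : G * ((1 - X ^ (1 + 1)) * (1 + X ^ 2) - X ^ (1 + 3) * (1 - X ^ 1) * (1 + X ^ (1 + 2)))
      + X ^ (1 + 1) * Zb (1 + 2) - X ^ 2 * (Qs * FB {n | 4 ≤ n}) =
      (G * ((1 - X ^ 1) * (1 - X ^ 4)) + X ^ 1 * (G * ((1 - X ^ 1) * (1 - X ^ 6)))) + X ^ 2 * Zb 3
      + X ^ 2 * (Qs * FB {n | 4 ≤ n} * (X ^ 4 * geo 4 * geo 6 + X ^ 6 * geo 6)) := by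
    linear_combination X ^ 2 * e3 + X ^ 2 * Qs * FB {n | 4 ≤ n} * (geo 6 * g4 + g6)
  rw [e4]
  have ng : ∀ n, NN (geo n) := fun n => NN_mgf _
  refine (((hG _ _ (by omega) (by omega) (by omega)).add ((NN_X_pow _).mul (hG _ _ (by omega) (by omega) (by omega)))).add
    ((NN_X_pow _).mul (NN_Zb _ (by omega)))).add ((NN_X_pow _).mul ((NN_Qs.mul (NN_mgf _)).mul ?_))
  exact (((NN_X_pow _).mul (ng _)).mul (ng _)).add ((NN_X_pow _).mul (ng _))

end Ospt

namespace Ospt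

open PowerSeries Finset

def cg (M : ℕ) (f g : ℤ⟦X⟧) : Prop := (X : ℤ⟦X⟧) ^ M ∣ f - g

lemma cg.trans {M : ℕ} {f g h : ℤ⟦X⟧} (h1 : cg M f g) (h2 : cg M g h) : cg M f h := by
  have := dvd_add h1 h2
  rwa [sub_add_sub_cancel] at this

lemma cg.sub {M : ℕ} {f g f' g' : ℤ⟦X⟧} (h1 : cg M f g) (h2 : cg M f' g') : cg M (f - f') (g - g') := by
  have := dvd_sub h1 h2
  unfold cg
  rwa [sub_sub_sub_comm]

lemma cg.add {M : ℕ} {f g f' g' : ℤ⟦X⟧} (h1 : cg M f g) (h2 : cg M f' g') : cg M (f + f') (g + g') := by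
  have := dvd_add h1 h2
  unfold cg
  rwa [add_sub_add_comm]

lemma cg.mul_left {M : ℕ} {f g : ℤ⟦X⟧} (h1 : cg M f g) (c : ℤ⟦X⟧) : cg M (c * f) (c * g) := by
  unfold cg
  rw [← mul_sub]
  exact Dvd.dvd.mul_left h1 c

lemma cg.rfl {M : ℕ} {f : ℤ⟦X⟧} : cg M f f := by unfold cg; simp

lemma cg_sum {M : ℕ} {ι : Type*} (s : Finset ι) (f g : ι → ℤ⟦X⟧) (h : ∀ i ∈ s, cg M (f i) (g i)) :
    cg M (∑ i ∈ s, f i) (∑ i ∈ s, g i) := by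
  unfold cg
  rw [← Finset.sum_sub_distrib]
  exact Finset.dvd_sum h

lemma C_unroll (l b : ℕ) : Ck b = Pb * ∑ s ∈ Finset.range l,
    (X ^ ((2 * s + 1) * (s + b)) - X ^ ((s + 1) * (2 * s + 1 + 2 * b)))
    + X ^ ((2 * l + 1) * (l + b)) * (Pb - Ck (b + 2 * l + 1)) := by
  induction l with
  | zero => rw [Ck_rec b]; simp
  | succ l ih =>
    rw [ih, Finset.sum_range_succ, Ck_rec (b + 2 * l + 1), Ck_rec (b + 2 * l + 1 + 1),
      show b + 2 * (l + 1) + 1 = b + 2 * l + 1 + 1 + 1 by ring]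
    ring

lemma A_unroll (M b : ℕ) (hb : 1 ≤ b) : Ak b = 2 * Pb * ∑ s ∈ Finset.range M,
    (X ^ ((2 * s + 1) * (2 * s + 1 + b)) - X ^ ((2 * s + 2) * (2 * s + 2 + b)))
    + X ^ (2 * M * (2 * M + b)) * Ak (b + 4 * M) := by
  induction M with
  | zero => simp
  | succ M ih =>
    rw [ih, Finset.sum_range_succ, Ak_rec (b + 4 * M) (by omega), Ak_rec (b + 4 * M + 2) (by omega),
      show b + 4 * (M + 1) = b + 4 * M + 2 + 2 by ring]
    ring

lemma geo_two (n : ℕ) (hn : 0 < n) : geo n = (1 + X ^ n) * geo (2 * n) := by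
  have h1 := geo_eq n hn
  have h2 := geo_eq (2 * n) (by omega)
  linear_combination (1 + X ^ n) * geo (2 * n) * h1 - geo n * h2

lemma tri_sum (u n : ℕ → ℕ) (hn : ∀ s, 0 < n s) (M : ℕ) :
    ∑ l ∈ Finset.range M, ∑ s ∈ Finset.range l, (X : ℤ⟦X⟧) ^ (u s + n s * l) =
    ∑ s ∈ Finset.range M, (X ^ (u s + n s * (s + 1)) - X ^ (u s + n s * M)) * geo (n s) := by
  induction M with
  | zero => simp
  | succ M ih =>
    rw [Finset.sum_range_succ, ih, Finset.sum_range_succ, sub_self, zero_mul, add_zero,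
      ← Finset.sum_add_distrib]
    refine Finset.sum_congr rfl fun s _ => ?_
    have := geo_eq (n s) (hn s)
    linear_combination (-X ^ (u s + n s * M)) * this

lemma tri_cg (u n : ℕ → ℕ) (hn : ∀ s, 0 < n s) (M : ℕ) :
    cg M (∑ l ∈ Finset.range M, ∑ s ∈ Finset.range l, (X : ℤ⟦X⟧) ^ (u s + n s * l))
      (∑ s ∈ Finset.range M, X ^ (u s + n s * (s + 1)) * geo (n s)) := by
  rw [tri_sum u n hn]
  refine cg_sum _ _ _ fun s _ => ?_
  unfold cg
  have : (X : ℤ⟦X⟧) ^ M ∣ X ^ (u s + n s * M) := pow_dvd_pow _ (by have := hn s; nlinarith)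
  obtain ⟨c, hc⟩ := this
  rw [hc]
  exact ⟨-c * geo (n s), by ring⟩

lemma geo_sum (v n : ℕ) (hn : 0 < n) (M : ℕ) :
    ∑ i ∈ Finset.range M, (X : ℤ⟦X⟧) ^ (v + n * i) = (X ^ v - X ^ (v + n * M)) * geo n := by
  have := geo_eq n hn
  induction M with
  | zero => simp
  | succ M ih =>
    rw [Finset.sum_range_succ, ih]
    linear_combination (-X ^ (v + n * M)) * this

lemma geo_cg (v n : ℕ) (hn : 0 < n) (M : ℕ) :
    cg M (∑ i ∈ Finset.range M, (X : ℤ⟦X⟧) ^ (v + n * i)) (X ^ v * geo n) := by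
  rw [geo_sum v n hn]
  unfold cg
  have : (X : ℤ⟦X⟧) ^ M ∣ X ^ (v + n * M) := pow_dvd_pow _ (by nlinarith)
  obtain ⟨c, hc⟩ := this
  rw [hc]
  exact ⟨-c * geo n, by ring⟩

lemma Ck_dvd (k : ℕ) : (X : ℤ⟦X⟧) ^ k ∣ Ck k := ⟨_, Ck_rec k⟩
lemma Ak_dvd (k : ℕ) (hk : 1 ≤ k) : (X : ℤ⟦X⟧) ^ (k + 1) ∣ Ak k := ⟨_, Ak_rec k hk⟩

noncomputable def Ej (j : ℕ) : ℤ⟦X⟧ := ssum (fun k => Ck (j + k)) - ssum (fun i => Ak (j + 2 * i))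

lemma SC_cg (j M : ℕ) : cg M (ssum (fun k => Ck (j + k)))
    (Pb * (∑ s ∈ Finset.range M, X ^ ((2 * s + 1) * (s + j) + (2 * s + 1) * (s + 1)) * geo (2 * s + 1)
      - ∑ s ∈ Finset.range M, X ^ ((s + 1) * (2 * s + 1 + 2 * j) + (2 * s + 2) * (s + 1)) * geo (2 * s + 2))
     + ∑ s ∈ Finset.range M, X ^ ((2 * s + 1) * (j + 2 * s)) * (Pb - Ck (3 * s + 1 + j))) := by
  have h1 : cg M (ssum (fun k => Ck (j + k))) (∑ k ∈ Finset.range M, Ck (j + k)) :=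
    ssum_spec _ (fun i => (pow_dvd_pow _ (by omega)).trans (Ck_dvd (j + i))) M
  refine h1.trans ?_
  have h2 : ∑ k ∈ Finset.range M, Ck (j + k) =
    Pb * (∑ l ∈ Finset.range M, ∑ s ∈ Finset.range l, X ^ ((2 * s + 1) * (s + j) + (2 * s + 1) * l) -
      ∑ l ∈ Finset.range M, ∑ s ∈ Finset.range l, X ^ ((s + 1) * (2 * s + 1 + 2 * j) + (2 * s + 2) * l)) +
    ∑ s ∈ Finset.range M, X ^ ((2 * s + 1) * (j + 2 * s)) * (Pb - Ck (3 * s + 1 + j)) := by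
    rw [← Finset.sum_sub_distrib, Finset.mul_sum, ← Finset.sum_add_distrib]
    refine Finset.sum_congr rfl fun l _ => ?_
    rw [C_unroll l (j + l), ← Finset.sum_sub_distrib, show j + l + 2 * l + 1 = 3 * l + 1 + j by ring,
      show (2 * l + 1) * (l + (j + l)) = (2 * l + 1) * (j + 2 * l) by ring]
    congr 2
    refine Finset.sum_congr rfl fun s _ => ?_
    congr 2 <;> ring
  rw [h2]
  refine cg.add (cg.mul_left (cg.sub ?_ ?_) _) cg.rfl
  · exact tri_cg (fun s => (2 * s + 1) * (s + j)) (fun s => 2 * s + 1) (fun s => by omega) M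
  · exact tri_cg (fun s => (s + 1) * (2 * s + 1 + 2 * j)) (fun s => 2 * s + 2) (fun s => by omega) M

lemma SA_cg (j M : ℕ) (hj : 1 ≤ j) : cg M (ssum (fun i => Ak (j + 2 * i)))
    (2 * Pb * ∑ s ∈ Finset.range M, (X ^ ((2 * s + 1) * (2 * s + 1 + j)) * geo (2 * (2 * s + 1))
      - X ^ ((2 * s + 2) * (2 * s + 2 + j)) * geo (2 * (2 * s + 2)))) := by
  have h1 : cg M (ssum (fun k => Ak (j + 2 * k))) (∑ k ∈ Finset.range M, Ak (j + 2 * k)) :=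
    ssum_spec _ (fun i => (pow_dvd_pow _ (by omega)).trans (Ak_dvd (j + 2 * i) (by omega))) M
  refine h1.trans ?_
  have h2 : cg M (∑ k ∈ Finset.range M, Ak (j + 2 * k)) (∑ k ∈ Finset.range M, 2 * Pb * ∑ s ∈ Finset.range M,
    (X ^ ((2 * s + 1) * (2 * s + 1 + j) + 2 * (2 * s + 1) * k) - X ^ ((2 * s + 2) * (2 * s + 2 + j) + 2 * (2 * s + 2) * k))) := by
    refine cg_sum _ _ _ fun k _ => ?_
    unfold cg
    rw [A_unroll M (j + 2 * k) (by omega)]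
    have e : ∑ s ∈ Finset.range M,
      ((X : ℤ⟦X⟧) ^ ((2 * s + 1) * (2 * s + 1 + (j + 2 * k))) - X ^ ((2 * s + 2) * (2 * s + 2 + (j + 2 * k)))) = ∑ s ∈ Finset.range M,
    (X ^ ((2 * s + 1) * (2 * s + 1 + j) + 2 * (2 * s + 1) * k) - X ^ ((2 * s + 2) * (2 * s + 2 + j) + 2 * (2 * s + 2) * k)) := by
      refine Finset.sum_congr rfl fun s _ => ?_
      congr 2 <;> ring
    rw [e, add_sub_cancel_left]
    refine Dvd.dvd.mul_right (pow_dvd_pow _ ?_) _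
    nlinarith
  refine h2.trans ?_
  rw [← Finset.mul_sum, Finset.sum_comm]
  refine cg.mul_left (cg_sum _ _ _ fun s _ => ?_) _
  rw [Finset.sum_sub_distrib]
  exact cg.sub (geo_cg _ _ (by omega) M) (geo_cg _ _ (by omega) M)

lemma Ej_cg (j M : ℕ) (hj : 1 ≤ j) :
    cg M (Ej j) (∑ s ∈ Finset.range M, X ^ ((2 * s + 1) * (j + 2 * s)) * Row s j) := by
  have h := (SC_cg j M).sub (SA_cg j M hj)
  refine h.trans ?_
  have : ∀ f g : ℤ⟦X⟧, f = g → cg M f g := fun f g h => by rw [h]; exact cg.rfl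
  apply this
  rw [← Finset.sum_sub_distrib, Finset.mul_sum, Finset.mul_sum, ← Finset.sum_add_distrib, ← Finset.sum_sub_distrib]
  refine Finset.sum_congr rfl fun s _ => ?_
  have g1 := geo_eq (2 * (2 * s + 1)) (by omega)
  rw [Row, geo_two (2 * s + 1) (by omega), geo_two (2 * s + 2) (by omega),
    show 2 * (2 * s + 2) = 4 * (s + 1) by ring]
  linear_combination (-Pb * X ^ ((2 * s + 1) * (j + 2 * s))) * g1

lemma NN_Row (l j : ℕ) (hj : 1 ≤ j) : NN (Row l j) := by
  rcases Nat.eq_zero_or_pos l with rfl | h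
  exacts [Row_zero_pos j hj, Row_pos l j h hj]

lemma NN_Ej (j : ℕ) (hj : 1 ≤ j) : NN (Ej j) := by
  intro n
  have h := PowerSeries.X_pow_dvd_iff.1 (Ej_cg j (n + 1) hj) n (by omega)
  rw [map_sub, sub_eq_zero] at h
  rw [h]
  exact NN_sum _ _ (fun i _ => (NN_X_pow _).mul (NN_Row i j hj)) n

lemma E1_ge : NN (Ej 1 - X ^ 3 * (Qs * FB {n | 4 ≤ n})) := by
  intro n
  have h := PowerSeries.X_pow_dvd_iff.1 (Ej_cg 1 (n + 1) le_rfl) n (by omega)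
  rw [map_sub, sub_eq_zero, Finset.sum_range_succ', map_add] at h
  have h1 := NN_sum (Finset.range n) (fun s => X ^ ((2 * (s + 1) + 1) * (1 + 2 * (s + 1))) * Row (s + 1) 1)
    (fun i _ => (NN_X_pow _).mul (NN_Row _ 1 le_rfl)) n
  have h2 := ((NN_X_pow 1).mul Row_one) n
  have e : X ^ ((2 * 0 + 1) * (1 + 2 * 0)) * Row 0 1 = X ^ 1 * (Row 0 1 - X ^ 2 * (Qs * FB {n | 4 ≤ n}))
      + X ^ 3 * (Qs * FB {n | 4 ≤ n}) := by ring
  rw [e, map_add] at h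
  rw [map_sub]
  linarith

end Ospt

namespace Ospt

open PowerSeries Finset

lemma NN_ogf (p) : NN (ogf p) := fun n => by simp [ogf]

lemma Tk_dvd (k : ℕ) (hk : 1 ≤ k) : (X : ℤ⟦X⟧) ^ k ∣ Tk k := by
  rw [PowerSeries.X_pow_dvd_iff]
  intro n hn
  have h := PowerSeries.X_pow_dvd_iff.1 (Ak_dvd k hk) n (by omega)
  rw [Ak, map_add] at h
  have h1 : 0 ≤ coeff n (Tk k) := NN_ogf _ n
  have h2 : 0 ≤ coeff n (Tk (k + 1)) := NN_ogf _ n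
  omega

lemma Nbar_T (k n : ℕ) : (Nbar (k : ℤ) n : ℤ) = coeff n (Tk k) - coeff n (Tk (k + 1)) := by
  rw [Nbar_eq]
  have h := ogf_split (fun x => (k : ℤ) ≤ rk x) (fun x => rk x = k)
  have e1 : ogf (fun x => (k : ℤ) ≤ rk x ∧ rk x = k) = ogf (fun x => rk x = k) :=
    ogf_congr fun x _ => by constructor <;> intro h <;> omega
  have e2 : ogf (fun x => (k : ℤ) ≤ rk x ∧ ¬ rk x = k) = Tk (k + 1) :=
    ogf_congr fun x _ => by push_cast; constructor <;> intro h <;> omega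
  rw [e1, e2] at h
  rw [Tk, h, map_add]
  ring

lemma Ej_dvd (j : ℕ) (hj : 1 ≤ j) : (X : ℤ⟦X⟧) ^ j ∣ Ej j := by
  refine dvd_sub ?_ ?_ <;> rw [PowerSeries.X_pow_dvd_iff] <;> intro m hm <;> rw [ssum, coeff_mk] <;>
    refine Finset.sum_eq_zero fun i _ => ?_
  · exact PowerSeries.X_pow_dvd_iff.1 (Ck_dvd (j + i)) m (by omega)
  · exact PowerSeries.X_pow_dvd_iff.1 (Ak_dvd (j + 2 * i) (by omega)) m (by omega)

lemma Ej_sub (j : ℕ) (hj : 1 ≤ j) : Ej j - Ej (j + 1) = Ck j - Tk j := by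
  apply eq_of_X_pow_dvd
  intro M
  obtain ⟨a, ha⟩ := ssum_mod (fun k => Ck (j + k)) (fun i => (pow_dvd_pow _ (by omega)).trans (Ck_dvd (j + i))) M
  obtain ⟨b, hb⟩ := ssum_mod (fun k => Ck (j + 1 + k)) (fun i => (pow_dvd_pow _ (by omega)).trans (Ck_dvd (j + 1 + i))) M
  obtain ⟨c, hc⟩ := ssum_mod (fun k => Ak (j + 2 * k)) (fun i => (pow_dvd_pow _ (by omega)).trans (Ak_dvd (j + 2 * i) (by omega))) M
  obtain ⟨d, hd⟩ := ssum_mod (fun k => Ak (j + 1 + 2 * k)) (fun i => (pow_dvd_pow _ (by omega)).trans (Ak_dvd (j + 1 + 2 * i) (by omega))) M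
  have e1 : ∀ M, ∑ k ∈ Finset.range M, Ck (j + k) = ∑ k ∈ Finset.range M, Ck (j + 1 + k) + Ck j - Ck (j + M) := by
    intro M
    induction M with
    | zero => simp
    | succ M ih =>
      rw [Finset.sum_range_succ, ih, Finset.sum_range_succ, show j + 1 + M = j + (M + 1) by ring]; ring
  have e2 : ∀ M, ∑ k ∈ Finset.range M, Ak (j + 2 * k) = ∑ k ∈ Finset.range M, Ak (j + 1 + 2 * k) + Tk j - Tk (j + 2 * M) := by
    intro M
    induction M with
    | zero => simp
    | succ M ih =>
      rw [Finset.sum_range_succ, ih, Finset.sum_range_succ, Ak, Ak, show j + 1 + 2 * M = j + 2 * M + 1 by ring,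
        show j + 2 * (M + 1) = j + 2 * M + 1 + 1 by ring]; ring
  obtain ⟨u, hu⟩ := (pow_dvd_pow (X : ℤ⟦X⟧) (by omega : M ≤ j + M)).trans (Ck_dvd (j + M))
  obtain ⟨v, hv⟩ := (pow_dvd_pow (X : ℤ⟦X⟧) (by omega : M ≤ j + 2 * M)).trans (Tk_dvd (j + 2 * M) (by omega))
  rw [Ej, Ej, ha, hb, hc, hd, e1, e2, hu, hv]
  exact ⟨a - b - c + d - u + v, by ring⟩

/-! ### the number of partitions into distinct parts -/

lemma coeff_Qs (n : ℕ) : coeff n Qs = ((DF n).card : ℤ) := by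
  simp [Qs, DA, fgf]

lemma DF_le (n : ℕ) (hn : 15 < n) : (DF n).card ≤ ∑ p ∈ Finset.Icc 6 n, (DF (n - p)).card := by
  have hsub : DF n ⊆ (Finset.Icc 6 n).biUnion (fun p => (DF (n - p)).image (fun O => insert p O)) := by
    intro O hO
    obtain ⟨h1, h2⟩ := mem_DF.1 hO
    have hex : ∃ p ∈ O, 6 ≤ p := by
      by_contra hcon
      push Not at hcon
      have : O ⊆ Finset.range 6 := fun i hi => Finset.mem_range.2 (hcon i hi)
      have h3 : O.sum id ≤ (Finset.range 6).sum id := Finset.sum_le_sum_of_subset this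
      have h4 : (Finset.range 6).sum id = 15 := by decide
      omega
    obtain ⟨p, hp, hp6⟩ := hex
    have h5 := Finset.sum_erase_add O id hp
    simp only [id] at h5 h2
    rw [Finset.mem_biUnion]
    refine ⟨p, Finset.mem_Icc.2 ⟨hp6, by omega⟩, Finset.mem_image.2 ⟨O.erase p, mem_DF.2 ⟨?_, ?_⟩, Finset.insert_erase hp⟩⟩
    · intro i hi; exact h1 i (Finset.mem_of_mem_erase hi)
    · simp only [id]; omega
  refine (Finset.card_le_card hsub).trans (Finset.card_biUnion_le.trans ?_)
  exact Finset.sum_le_sum fun p _ => Finset.card_image_le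

lemma DF_pos (n : ℕ) (hn : 0 < n) : 0 < (DF n).card := by
  refine Finset.card_pos.2 ⟨{n}, mem_DF.2 ⟨?_, by simp⟩⟩
  intro i hi
  rw [Finset.mem_singleton.1 hi]; exact hn

lemma FB4_zero : 1 ≤ coeff 0 (FB {n | 4 ≤ n}) := by
  classical
  simp only [FB, mgf, coeff_mk]
  have : 0 < ((PM 0).filter (fun M => ∀ i ∈ M, i ∈ {n | 4 ≤ n})).card := by
    refine Finset.card_pos.2 ⟨0, Finset.mem_filter.2 ⟨mem_PM.2 ⟨by simp, by simp⟩, by simp⟩⟩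
  have h2 : 0 < (Finset.filter (fun M => ∀ i ∈ M, i ∈ {n | 4 ≤ n}) (PM 0)).card := this
  have h3 : (1 : ℤ) ≤ ((Finset.filter (fun M => ∀ i ∈ M, i ∈ {n | 4 ≤ n}) (PM 0)).card : ℤ) := by
    exact_mod_cast h2
  convert h3

lemma FB4_ge (k : ℕ) (hk : 4 ≤ k) : 1 ≤ coeff k (FB {n | 4 ≤ n}) := by
  classical
  simp only [FB, mgf, coeff_mk]
  have h2 : 0 < (Finset.filter (fun M => ∀ i ∈ M, i ∈ {n | 4 ≤ n}) (PM k)).card := by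
    refine Finset.card_pos.2 ⟨{k}, Finset.mem_filter.2 ⟨mem_PM.2 ⟨?_, by simp⟩, by simpa using hk⟩⟩
    intro i hi
    rw [Multiset.mem_singleton.1 hi]; omega
  have h3 : (1 : ℤ) ≤ ((Finset.filter (fun M => ∀ i ∈ M, i ∈ {n | 4 ≤ n}) (PM k)).card : ℤ) := by
    exact_mod_cast h2
  convert h3

lemma Q_lt (N : ℕ) (hN : 17 ≤ N) : coeff N (X * Qs) < coeff N (X ^ 3 * (Qs * FB {n | 4 ≤ n})) := by
  obtain ⟨n, rfl⟩ : ∃ n, N = n + 3 := ⟨N - 3, by omega⟩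
  rw [coeff_X_pow_mul, show n + 3 = n + 2 + 1 by ring, coeff_succ_X_mul, mul_comm Qs, coeff_mul,
    Finset.Nat.sum_antidiagonal_eq_sum_range_succ_mk, coeff_Qs]
  have h1 : ∑ k ∈ insert 0 (Finset.Icc 4 n), coeff k (FB {n | 4 ≤ n}) * coeff (n - k) Qs ≤
      ∑ k ∈ Finset.range n.succ, coeff k (FB {n | 4 ≤ n}) * coeff (n - k) Qs := by
    refine Finset.sum_le_sum_of_subset_of_nonneg ?_ fun i _ _ => mul_nonneg (NN_mgf _ _) (NN_Qs _)
    intro i hi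
    rw [Finset.mem_insert, Finset.mem_Icc] at hi
    rw [Finset.mem_range]; omega
  rw [Finset.sum_insert (by simp)] at h1
  have h2 : ∑ k ∈ Finset.Icc 4 n, coeff (n - k) Qs ≤
      ∑ k ∈ Finset.Icc 4 n, coeff k (FB {n | 4 ≤ n}) * coeff (n - k) Qs := by
    refine Finset.sum_le_sum fun k hk => ?_
    exact le_mul_of_one_le_left (NN_Qs _) (FB4_ge k (Finset.mem_Icc.1 hk).1)
  have h3 : coeff (n - 0) Qs ≤ coeff 0 (FB {n | 4 ≤ n}) * coeff (n - 0) Qs :=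
    le_mul_of_one_le_left (NN_Qs _) FB4_zero
  have h4 := DF_le (n + 2) (by omega)
  have h5 : ∑ p ∈ Finset.Icc 6 (n + 2), (DF (n + 2 - p)).card = ∑ k ∈ Finset.Icc 4 n, (DF (n - k)).card := by
    symm
    refine Finset.sum_nbij' (fun k => k + 2) (fun p => p - 2) ?_ ?_ ?_ ?_ ?_
    · intro k hk; rw [Finset.mem_Icc] at *; omega
    · intro k hk; rw [Finset.mem_Icc] at *; omega
    · intro k hk; simp
    · intro k hk; rw [Finset.mem_Icc] at hk; omega
    · intro k hk; congr 2; omega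
  have h6 := DF_pos n (by omega)
  rw [h5] at h4
  have h4' : ((DF (n + 2)).card : ℤ) ≤ ∑ k ∈ Finset.Icc 4 n, coeff (n - k) Qs := by
    simp_rw [coeff_Qs]; exact_mod_cast h4
  rw [Nat.sub_zero, coeff_Qs] at h3
  have h6' : (0 : ℤ) < (DF n).card := by exact_mod_cast h6
  rw [Nat.sub_zero, coeff_Qs n] at h1
  dsimp only
  linarith

/-! ### summation by parts -/

lemma convex_pow (r m : ℕ) : 2 * ((m : ℤ) + 1) ^ r ≤ ((m : ℤ) + 2) ^ r + (m : ℤ) ^ r := by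
  induction r with
  | zero => simp
  | succ r ih =>
    have h : (m : ℤ) ^ r ≤ ((m : ℤ) + 2) ^ r := pow_le_pow_left₀ (by positivity) (by omega) r
    rw [pow_succ, pow_succ, pow_succ]
    have : 0 ≤ (m : ℤ) + 1 := by positivity
    nlinarith [mul_le_mul_of_nonneg_left ih this]

lemma abel1 (r : ℕ) (hr : 1 ≤ r) (g : ℕ → ℤ) (n : ℕ) :
    ∑ m ∈ Finset.range n, ((m : ℤ) + 1) ^ r * (g m - g (m + 1)) =
      ∑ m ∈ Finset.range n, (((m : ℤ) + 1) ^ r - (m : ℤ) ^ r) * g m - (n : ℤ) ^ r * g n := by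
  induction n with
  | zero => simp [show r ≠ 0 by omega]
  | succ n ih =>
    rw [Finset.sum_range_succ, ih, Finset.sum_range_succ]; push_cast; ring

lemma abel2 (r : ℕ) (hr : 1 ≤ r) (s : ℕ → ℤ) (hs : ∀ m, 0 ≤ s m) (n : ℕ) :
    s 0 - (((n : ℤ) + 1) ^ r - (n : ℤ) ^ r) * s n ≤
    ∑ m ∈ Finset.range n, (((m : ℤ) + 1) ^ r - (m : ℤ) ^ r) * (s m - s (m + 1)) := by
  induction n with
  | zero => simp [show r ≠ 0 by omega]
  | succ n ih =>
    rw [Finset.sum_range_succ]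
    have h1 := convex_pow r n
    have h2 : ((n : ℤ) + 1) ^ r - (n : ℤ) ^ r ≤ ((n : ℤ) + 2) ^ r - ((n : ℤ) + 1) ^ r := by linarith
    have h3 := mul_le_mul_of_nonneg_right h2 (hs (n + 1))
    push_cast
    rw [show (n : ℤ) + 1 + 1 = n + 2 by ring]
    linarith

lemma main_int (r : ℕ) (hr : 1 ≤ r) (N : ℕ) (hN : 17 ≤ N) :
    0 < ∑ m ∈ Finset.range N, ((m : ℤ) + 1) ^ r * (Mbar ((m : ℤ) + 1) N : ℤ) -
      ∑ m ∈ Finset.range N, ((m : ℤ) + 1) ^ r * (Nbar ((m : ℤ) + 1) N : ℤ) := by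
  have hM : ∀ m : ℕ, (Mbar ((m : ℤ) + 1) N : ℤ) = (coeff N (Ck (m + 1)) - coeff N (Ck (m + 1 + 1)))
      - (if m = 0 then coeff N (X * Qs) else 0) := by
    intro m
    have h1 := Mbar_eq (m + 1) N
    have h2 := congrArg (coeff N) (cr_Ck (m + 1) (by omega))
    push_cast at h1
    rw [h1]
    rw [map_add, map_sub] at h2
    by_cases hm : m = 0
    · subst hm; simp at h2 ⊢; linarith
    · simp [hm] at h2 ⊢; linarith
  have hNb : ∀ m : ℕ, (Nbar ((m : ℤ) + 1) N : ℤ) = coeff N (Tk (m + 1)) - coeff N (Tk (m + 1 + 1)) := by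
    intro m
    have h1 := Nbar_T (m + 1) N
    push_cast at h1
    exact h1
  have e1 : ∑ m ∈ Finset.range N, ((m : ℤ) + 1) ^ r * (Mbar ((m : ℤ) + 1) N : ℤ) =
      ∑ m ∈ Finset.range N, ((m : ℤ) + 1) ^ r * (coeff N (Ck (m + 1)) - coeff N (Ck (m + 1 + 1))) - coeff N (X * Qs) := by
    have : ∑ m ∈ Finset.range N, ((m : ℤ) + 1) ^ r * (if m = 0 then coeff N (X * Qs) else 0) = coeff N (X * Qs) := by
      rw [Finset.sum_eq_single 0]
      · simp
      · intro b _ hb; simp [hb]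
      · intro h; simp at h; omega
    rw [← this, ← Finset.sum_sub_distrib]
    refine Finset.sum_congr rfl fun m _ => ?_
    rw [hM]; ring
  have e2 : ∑ m ∈ Finset.range N, ((m : ℤ) + 1) ^ r * (Nbar ((m : ℤ) + 1) N : ℤ) =
      ∑ m ∈ Finset.range N, ((m : ℤ) + 1) ^ r * (coeff N (Tk (m + 1)) - coeff N (Tk (m + 1 + 1))) :=
    Finset.sum_congr rfl fun m _ => by rw [hNb]
  have a1 := abel1 r hr (fun m => coeff N (Ck (m + 1))) N
  have a2 := abel1 r hr (fun m => coeff N (Tk (m + 1))) N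
  have a3 := abel2 r hr (fun m => coeff N (Ej (m + 1))) (fun m => NN_Ej (m + 1) (by omega) N) N
  have z1 : coeff N (Ck (N + 1)) = 0 := PowerSeries.X_pow_dvd_iff.1 (Ck_dvd _) N (by omega)
  have z2 : coeff N (Tk (N + 1)) = 0 := PowerSeries.X_pow_dvd_iff.1 (Tk_dvd _ (by omega)) N (by omega)
  have z3 : coeff N (Ej (N + 1)) = 0 := PowerSeries.X_pow_dvd_iff.1 (Ej_dvd _ (by omega)) N (by omega)
  simp only [z1, z2, z3, mul_zero, sub_zero] at a1 a2 a3
  rw [e1, e2, a1, a2]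
  have h4 : ∑ m ∈ Finset.range N, (((m : ℤ) + 1) ^ r - (m : ℤ) ^ r) * (coeff N (Ej (m + 1)) - coeff N (Ej (m + 1 + 1)))
      = ∑ m ∈ Finset.range N, (((m : ℤ) + 1) ^ r - (m : ℤ) ^ r) * coeff N (Ck (m + 1)) -
        ∑ m ∈ Finset.range N, (((m : ℤ) + 1) ^ r - (m : ℤ) ^ r) * coeff N (Tk (m + 1)) := by
    rw [← Finset.sum_sub_distrib]
    refine Finset.sum_congr rfl fun m _ => ?_
    rw [← map_sub, Ej_sub _ (by omega), map_sub]; ring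
  rw [h4] at a3
  have h5 := E1_ge N
  rw [map_sub] at h5
  have h6 := Q_lt N hN
  have h7 : coeff N (Ej (0 + 1)) = coeff N (Ej 1) := rfl
  linarith

lemma Mbar_zero (m N : ℕ) (hN : 1 ≤ N) (hm : N ≤ m) : Mbar ((m : ℤ) + 1) N = 0 := by
  have h1 := Mbar_eq (m + 1) N
  have h2 := congrArg (coeff N) (cr_Ck (m + 1) (by omega))
  have z1 : coeff N (Ck (m + 1)) = 0 := PowerSeries.X_pow_dvd_iff.1 (Ck_dvd _) N (by omega)
  have z2 : coeff N (Ck (m + 1 + 1)) = 0 := PowerSeries.X_pow_dvd_iff.1 (Ck_dvd _) N (by omega)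
  rw [if_neg (by omega), add_zero, map_sub, z1, z2, ← h1] at h2
  push_cast at h2
  exact_mod_cast h2

lemma Nbar_zero (m N : ℕ) (hm : N ≤ m) : Nbar ((m : ℤ) + 1) N = 0 := by
  have h1 := Nbar_T (m + 1) N
  have z1 : coeff N (Tk (m + 1)) = 0 := PowerSeries.X_pow_dvd_iff.1 (Tk_dvd _ (by omega)) N (by omega)
  have z2 : coeff N (Tk (m + 1 + 1)) = 0 := PowerSeries.X_pow_dvd_iff.1 (Tk_dvd _ (by omega)) N (by omega)
  rw [z1, z2] at h1
  push_cast at h1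
  exact_mod_cast h1

lemma main (r : ℕ) (hr : 1 ≤ r) (N : ℕ) (hN : 17 ≤ N) : 0 < Mplus r N - Nplus r N := by
  have h := main_int r hr N hN
  rw [Mplus, Nplus, tsum_eq_sum (s := Finset.range N), tsum_eq_sum (s := Finset.range N)]
  · exact_mod_cast h
  · intro m hm
    rw [Nbar_zero m N (by simpa using hm)]; simp
  · intro m hm
    rw [Mbar_zero m N (by omega) (by simpa using hm)]; simp

end Ospt

/-- For every integer `r ≥ 1` there exists `n_r ∈ ℕ` such that
`M̄_r^+(N) - N̄_r^+(N) > 0` for all `N ≥ n_r`. -/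
theorem ospt_positive (r : ℕ) (hr : 1 ≤ r) :
    ∃ nr : ℕ, ∀ N : ℕ, nr ≤ N → 0 < Mplus r N - Nplus r N := by
  exact ⟨17, fun N hN => Ospt.main r hr N hN⟩
end

section
/- For every integer r ≥ 1 and every complex q with |q| < 1, the generating function of the positive symmetrized rank moments satisfies Σ_{n≥0} η̄_r^+(n) q^n = 2·((−q;q)_∞/(q;q)_∞) · Σ_{n≥1} (−1)^{n+1} q^{n² + (r/2 + ρ_R(r))n} / ((1 + q^n)(1 − q^n)^r), where all exponents n² + (r/2 + ρ_R(r))n are nonnegative integers. -/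
open scoped BigOperators
open Filter MeasureTheory

namespace OPProof

abbrev Om := Finset ℕ × Multiset ℕ

def wt (p : Om) : ℕ := p.1.sum id + p.2.sum

def OP : ℕ → ℕ → Finset Om
  | 0, _ => {(∅, 0)}
  | _ + 1, 0 => {(∅, 0)}
  | L + 1, k + 1 => OP L (k + 1) ∪ ((OP (L + 1) k).image (fun p => (p.1, (L + 1) ::ₘ p.2)) ∪
      (OP L k).image (fun p => (insert (L + 1) p.1, p.2)))

lemma mem_OP (L k : ℕ) (p : Om) : p ∈ OP L k ↔
    (∀ i ∈ p.1, 0 < i ∧ i ≤ L) ∧ (∀ i ∈ p.2, 0 < i ∧ i ≤ L) ∧ p.1.card + p.2.card ≤ k := by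
  induction L, k using OP.induct generalizing p with
  | case1 k =>
    obtain ⟨s, t⟩ := p
    simp only [OP, Finset.mem_singleton, Prod.mk.injEq]
    constructor
    · rintro ⟨rfl, rfl⟩; simp
    · rintro ⟨h1, h2, h3⟩
      refine ⟨Finset.eq_empty_of_forall_notMem fun i hi => ?_,
        Multiset.eq_zero_of_forall_notMem fun i hi => ?_⟩
      · have := h1 i hi; omega
      · have := h2 i hi; omega
  | case2 L =>
    obtain ⟨s, t⟩ := p
    simp only [OP, Finset.mem_singleton, Prod.mk.injEq]
    constructor
    · rintro ⟨rfl, rfl⟩; simp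
    · rintro ⟨h1, h2, h3⟩
      simp only [Nat.le_zero, Nat.add_eq_zero_iff, Finset.card_eq_zero, Multiset.card_eq_zero] at h3
      exact h3
  | case3 L k ih1 ih2 ih3 =>
    obtain ⟨s, t⟩ := p
    simp only [OP, Finset.mem_union, Finset.mem_image, ih1, ih2, ih3]
    constructor
    · rintro (⟨h1, h2, h3⟩ | ⟨⟨s', t'⟩, ⟨h1, h2, h3⟩, h4⟩ | ⟨⟨s', t'⟩, ⟨h1, h2, h3⟩, h4⟩)
      · refine ⟨fun i hi => ?_, fun i hi => ?_, h3⟩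
        · have := h1 i hi; omega
        · have := h2 i hi; omega
      · simp only [Prod.mk.injEq] at h4
        obtain ⟨rfl, rfl⟩ := h4
        refine ⟨h1, fun i hi => ?_, ?_⟩
        · rcases Multiset.mem_cons.1 hi with h | h
          · omega
          · exact h2 i h
        · simp at h3 ⊢; omega
      · simp only [Prod.mk.injEq] at h4
        obtain ⟨rfl, rfl⟩ := h4
        refine ⟨fun i hi => ?_, fun i hi => ?_, ?_⟩
        · rcases Finset.mem_insert.1 hi with h | h
          · omega
          · have := h1 i h; omega
        · have := h2 i hi; omega
        · have := Finset.card_insert_le (L + 1) s'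
          simp only at h3 ⊢; omega
    · rintro ⟨h1, h2, h3⟩
      by_cases ht : L + 1 ∈ t
      · right; left
        obtain ⟨t', rfl⟩ := Multiset.exists_cons_of_mem ht
        refine ⟨(s, t'), ⟨h1, fun i hi => h2 i (Multiset.mem_cons_of_mem hi), ?_⟩, rfl⟩
        simp only [Multiset.card_cons] at h3 ⊢; omega
      · have h2' : ∀ i ∈ t, 0 < i ∧ i ≤ L := fun i hi => by
          have := h2 i hi
          have : i ≠ L + 1 := by rintro rfl; exact ht hi
          omega
        by_cases hs : L + 1 ∈ s
        · right; right
          refine ⟨(s.erase (L + 1), t), ⟨fun i hi => ?_, h2', ?_⟩, ?_⟩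
          · have := h1 i (Finset.mem_of_mem_erase hi)
            have := Finset.ne_of_mem_erase hi
            omega
          · have := Finset.card_erase_of_mem hs
            have := Finset.card_pos.2 ⟨_, hs⟩
            simp only; omega
          · simp [Finset.insert_erase hs]
        · left
          refine ⟨fun i hi => ?_, h2', h3⟩
          have := h1 i hi
          have : i ≠ L + 1 := by rintro rfl; exact hs hi
          omega

noncomputable def D {R : Type*} [CommRing R] (q : R) (L k : ℕ) : R := ∑ p ∈ OP L k, q ^ wt p

section
variable {R : Type*} [CommRing R] (q : R)

lemma D_zero_left (k : ℕ) : D q 0 k = 1 := by simp [D, OP, wt]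

lemma D_zero_right (L : ℕ) : D q L 0 = 1 := by cases L <;> simp [D, OP, wt]

lemma D_rec (L k : ℕ) : D q (L + 1) (k + 1) =
    D q L (k + 1) + q ^ (L + 1) * (D q (L + 1) k + D q L k) := by
  unfold D
  rw [OP, Finset.sum_union, Finset.sum_union, Finset.sum_image, Finset.sum_image, mul_add,
    Finset.mul_sum, Finset.mul_sum]
  · congr 2
    · refine Finset.sum_congr rfl fun p _ => ?_
      simp only [wt, Multiset.sum_cons, ← pow_add]; congr 1; ring
    · refine Finset.sum_congr rfl fun p hp => ?_
      rw [mem_OP] at hp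
      have : L + 1 ∉ p.1 := fun h => by have := hp.1 _ h; omega
      simp only [wt, Finset.sum_insert this, ← pow_add, id]; congr 1; ring
  · intro p hp p' hp' h
    simp only [Prod.mk.injEq] at h
    have hp := (mem_OP _ _ _).1 hp
    have hp' := (mem_OP _ _ _).1 hp'
    have h1 : L + 1 ∉ p.1 := fun h => by have := hp.1 _ h; omega
    have h1' : L + 1 ∉ p'.1 := fun h => by have := hp'.1 _ h; omega
    refine Prod.ext ?_ h.2
    rw [← Finset.erase_insert h1, h.1, Finset.erase_insert h1']
  · intro p hp p' hp' h
    simp only [Prod.mk.injEq, Multiset.cons_inj_right] at h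
    exact Prod.ext h.1 h.2
  · rw [Finset.disjoint_left]
    intro p hp hp'
    simp only [Finset.mem_image] at hp hp'
    obtain ⟨a, ha, rfl⟩ := hp
    obtain ⟨b, hb, h⟩ := hp'
    simp only [Prod.mk.injEq] at h
    have := ((mem_OP _ _ _).1 hb).2.1 (L + 1) (by rw [h.2]; simp)
    omega
  · rw [Finset.disjoint_left]
    intro p hp hp'
    rw [mem_OP] at hp
    simp only [Finset.mem_union, Finset.mem_image] at hp'
    rcases hp' with ⟨a, ha, rfl⟩ | ⟨a, ha, rfl⟩
    · have := hp.2.1 (L + 1) (by simp)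
      omega
    · have := hp.1 (L + 1) (by simp)
      omega

/-- The recurrence in the other variable (conjugation). -/
lemma D_rec' (L k : ℕ) : D q (L + 1) (k + 1) =
    D q (L + 1) k + q ^ (k + 1) * (D q L (k + 1) + D q L k) := by
  induction L generalizing k with
  | zero =>
    induction k with
    | zero => simp only [D_rec, D_zero_left, D_zero_right]
    | succ k ih =>
      have e1 := D_rec q 0 (k + 1)
      have e2 := D_rec q 0 k
      simp only [D_zero_left] at *
      linear_combination e1 - e2 + q * ih
  | succ L ihL =>
    induction k with
    | zero =>
      have h1 := ihL 0
      have h2 := D_rec q (L+1) 0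
      have h3 := D_rec q L 0
      simp only [D_zero_right, zero_add] at *
      linear_combination h2 + h1 - q * h3
    | succ k ih =>
      have e1 := D_rec q (L + 1) (k + 1)
      have e2 := D_rec q (L + 1) k
      have e3 := D_rec q L (k + 1)
      have e4 := D_rec q L k
      have i1 := ihL (k + 1)
      have i2 := ihL k
      linear_combination e1 - e2 + i1 + q ^ (L + 2) * ih + q ^ (L + 2) * i2 - q ^ (k + 2) * e3
        - q ^ (k + 2) * e4

end
end OPProof

namespace OPProof

def Valid (p : Om) : Prop := (∀ i ∈ p.1, 0 < i) ∧ (∀ i ∈ p.2, 0 < i)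

def sp (p : Om) : ℕ := (p.1.val + p.2).sup
def cd (p : Om) : ℕ := Multiset.card (p.1.val + p.2)

lemma mem_OP' (L k : ℕ) (p : Om) : p ∈ OP L k ↔ Valid p ∧ sp p ≤ L ∧ cd p ≤ k := by
  rw [mem_OP]
  simp only [Valid, sp, cd, Multiset.sup_le, Multiset.mem_add, Multiset.card_add, Finset.card_val,
    Finset.mem_val]
  constructor
  · rintro ⟨h1, h2, h3⟩
    refine ⟨⟨fun i hi => (h1 i hi).1, fun i hi => (h2 i hi).1⟩, ?_, h3⟩
    rintro i (hi | hi)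
    · exact (h1 i hi).2
    · exact (h2 i hi).2
  · rintro ⟨⟨h1, h2⟩, h3, h4⟩
    exact ⟨fun i hi => ⟨h1 i hi, h3 i (Or.inl hi)⟩, fun i hi => ⟨h2 i hi, h3 i (Or.inr hi)⟩, h4⟩

open Classical in
noncomputable def f (q : ℂ) (p : Om) : ℂ := if Valid p then q ^ wt p else 0

lemma f_of_mem {q : ℂ} {L k : ℕ} {p : Om} (h : p ∈ OP L k) : f q p = q ^ wt p := by
  simp [f, ((mem_OP' _ _ _).1 h).1]

lemma D_nonneg {x : ℝ} (hx : 0 ≤ x) (L k : ℕ) : 0 ≤ D x L k :=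
  Finset.sum_nonneg fun _ _ => by positivity

lemma OP_mono {L L' k k' : ℕ} (hL : L ≤ L') (hk : k ≤ k') : OP L k ⊆ OP L' k' := by
  intro p
  simp only [mem_OP']
  rintro ⟨h, h1, h2⟩
  exact ⟨h, h1.trans hL, h2.trans hk⟩

lemma D_mono {x : ℝ} (hx : 0 ≤ x) {L L' k k' : ℕ} (hL : L ≤ L') (hk : k ≤ k') :
    D x L k ≤ D x L' k' :=
  Finset.sum_le_sum_of_subset_of_nonneg (OP_mono hL hk) fun _ _ _ => by positivity

lemma D_bound {x : ℝ} (hx : 0 ≤ x) (hx1 : x < 1) : ∃ M : ℝ, 0 ≤ M ∧ ∀ L k, D x L k ≤ M := by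
  -- exponential bound
  have hstep : ∀ L k, D x (L + 1) k ≤ D x L k * Real.exp (2 / (1 - x) * x ^ (L + 1)) := by
    intro L k
    have hxL : x ^ (L + 1) ≤ x := by
      simpa using pow_le_pow_of_le_one hx hx1.le (show 1 ≤ L + 1 by omega)
    have hx0 : 0 ≤ x ^ (L + 1) := by positivity
    have hD := D_nonneg hx L k
    have h1 : D x (L + 1) k ≤ D x L k + x ^ (L + 1) * (D x (L + 1) k + D x L k) := by
      cases k with
      | zero => simp only [D_zero_right]; nlinarith
      | succ k =>
        rw [D_rec]
        have a := D_mono hx (le_refl (L + 1)) (Nat.le_succ k)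
        have b := D_mono hx (le_refl L) (Nat.le_succ k)
        have : x ^ (L + 1) * (D x (L + 1) k + D x L k) ≤
          x ^ (L + 1) * (D x (L + 1) (k+1) + D x L (k+1)) := by gcongr
        rw [D_rec] at this
        linarith
    have h2 : D x (L + 1) k * (1 - x ^ (L + 1)) ≤ D x L k * (1 + x ^ (L + 1)) := by linarith
    have h3 : 1 + x ^ (L + 1) ≤ (1 + 2 / (1 - x) * x ^ (L + 1)) * (1 - x ^ (L + 1)) := by
      have : 0 < 1 - x := by linarith
      have e : (1 + 2 / (1 - x) * x ^ (L + 1)) * (1 - x ^ (L + 1)) - (1 + x ^ (L + 1)) =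
        2 * x ^ (L + 1) * (x - x ^ (L + 1)) / (1 - x) := by field_simp; ring
      have : 0 ≤ 2 * x ^ (L + 1) * (x - x ^ (L + 1)) / (1 - x) := by
        apply div_nonneg _ this.le
        have : 0 ≤ x - x ^ (L + 1) := by linarith
        positivity
      linarith
    have h4 : D x (L + 1) k ≤ D x L k * (1 + 2 / (1 - x) * x ^ (L + 1)) := by
      have : 0 < 1 - x ^ (L + 1) := by linarith
      refine le_of_mul_le_mul_right ?_ this
      calc _ ≤ _ := h2
        _ ≤ D x L k * ((1 + 2 / (1 - x) * x ^ (L + 1)) * (1 - x ^ (L + 1))) := by gcongr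
        _ = _ := by ring
    refine h4.trans ?_
    gcongr
    rw [add_comm]
    exact Real.add_one_le_exp _
  have hall : ∀ L k, D x L k ≤ Real.exp (∑ j ∈ Finset.range L, 2 / (1 - x) * x ^ (j + 1)) := by
    intro L k
    induction L with
    | zero => simp [D_zero_left]
    | succ L ih =>
      rw [Finset.sum_range_succ, Real.exp_add]
      exact (hstep L k).trans (by gcongr)
  have hs : Summable (fun j : ℕ => 2 / (1 - x) * x ^ (j + 1)) := by
    apply Summable.mul_left
    exact (summable_nat_add_iff 1).2 (summable_geometric_of_lt_one hx hx1)
  have : 0 < 1 - x := by linarith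
  refine ⟨Real.exp (∑' j : ℕ, 2 / (1 - x) * x ^ (j + 1)), by positivity, fun L k => (hall L k).trans ?_⟩
  gcongr
  exact hs.sum_le_tsum _ fun i _ => by positivity

lemma norm_D_le (q : ℂ) (L k : ℕ) : ‖D q L k‖ ≤ D ‖q‖ L k := by
  refine (norm_sum_le _ _).trans (le_of_eq ?_)
  simp [D]

lemma summable_norm_f {q : ℂ} (hq : ‖q‖ < 1) : Summable (fun p => ‖f q p‖) := by
  obtain ⟨M, hM0, hM⟩ := D_bound (norm_nonneg q) hq
  refine summable_of_sum_le (c := M) (fun _ => norm_nonneg _) fun u => ?_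
  classical
  have : ∑ p ∈ u, ‖f q p‖ = ∑ p ∈ u.filter Valid, ‖q‖ ^ wt p := by
    rw [Finset.sum_filter]
    refine Finset.sum_congr rfl fun p _ => ?_
    by_cases h : Valid p <;> simp [f, h]
  rw [this]
  refine le_trans ?_ (hM (u.sup sp) (u.sup cd))
  refine Finset.sum_le_sum_of_subset_of_nonneg ?_ fun _ _ _ => by positivity
  intro p hp
  rw [Finset.mem_filter] at hp
  rw [mem_OP']
  exact ⟨hp.2, Finset.le_sup (f := sp) hp.1, Finset.le_sup (f := cd) hp.1⟩

noncomputable def W (q : ℂ) (U : Set Om) : ℂ := ∑' p, U.indicator (f q) p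

lemma summable_ind {q : ℂ} (hq : ‖q‖ < 1) (U : Set Om) : Summable (U.indicator (f q)) :=
  (summable_norm_f hq).of_norm.indicator U

lemma W_finset (q : ℂ) (T : Finset Om) : W q (T : Set Om) = ∑ p ∈ T, f q p := by
  unfold W
  rw [tsum_eq_sum (s := T)]
  · exact Finset.sum_congr rfl fun p hp => by simp [hp]
  · intro p hp; simp [hp]

lemma W_OP (q : ℂ) (L k : ℕ) : W q (OP L k : Set Om) = D q L k := by
  rw [W_finset]
  exact Finset.sum_congr rfl fun p hp => f_of_mem hp

lemma hasSum_fib {q : ℂ} (hq : ‖q‖ < 1) (U : Set Om) (T : ℕ → Finset Om) (g : Om → ℕ)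
    (h : ∀ c p, p ∈ T c ↔ (p ∈ U ∧ Valid p) ∧ g p = c) :
    HasSum (fun c => ∑ p ∈ T c, f q p) (W q U) := by
  have := (summable_ind hq U).hasSum.tsum_fiberwise g
  suffices e : (fun c => ∑ p ∈ T c, f q p) = fun c => ∑' b : (g ⁻¹' {c}), U.indicator (f q) b by
    rw [e]; exact this
  funext c
  rw [tsum_subtype (g ⁻¹' {c}) (U.indicator (f q)), ← W_finset]
  unfold W
  congr 1
  funext p
  have hh := h c p
  by_cases hV : Valid p
  · by_cases h1 : p ∈ U <;> by_cases h2 : g p = c <;> simp_all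
  · simp [Set.indicator, f, hV]

lemma W_add {q : ℂ} (hq : ‖q‖ < 1) (U V : Set Om) (h : Disjoint U V) :
    W q (U ∪ V) = W q U + W q V := by
  unfold W
  rw [← (summable_ind hq U).tsum_add (summable_ind hq V), Set.indicator_union_of_disjoint h]

lemma tendsto_W {q : ℂ} (hq : ‖q‖ < 1) (U : ℕ → Set Om) (V : Set Om)
    (h : ∀ p, Valid p → ∀ᶠ n in atTop, (p ∈ U n ↔ p ∈ V)) :
    Tendsto (fun n => W q (U n)) atTop (nhds (W q V)) := by
  unfold W
  refine tendsto_tsum_of_dominated_convergence (summable_norm_f hq) (fun p => ?_)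
    (Eventually.of_forall fun n p => norm_indicator_le_norm_self _ _)
  by_cases hV : Valid p
  · refine tendsto_const_nhds.congr' ?_
    filter_upwards [h p hV] with n hn
    by_cases hp : p ∈ V <;> simp [hn, hp]
  · simp [Set.indicator, f, hV]

/-- The product formula for all overpartitions. -/
lemma W_univ {q : ℂ} (hq : ‖q‖ < 1) :
    W q Set.univ = (∏' j : ℕ, (1 - (-q) * q ^ j)) / ∏' j : ℕ, (1 - q * q ^ j) := by
  set S : ℕ → Set Om := fun L => {p | Valid p ∧ sp p ≤ L} with hS
  have t1 : ∀ L, Tendsto (fun k => D q L k) atTop (nhds (W q (S L))) := by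
    intro L
    simp_rw [← W_OP]
    refine tendsto_W hq _ _ fun p hp => ?_
    filter_upwards [eventually_ge_atTop (cd p)] with k hk
    simp [mem_OP', hS, hk]
  have t2 : Tendsto (fun L => W q (S L)) atTop (nhds (W q Set.univ)) := by
    refine tendsto_W hq _ _ fun p hp => ?_
    filter_upwards [eventually_ge_atTop (sp p)] with k hk
    simp [hS, hk, hp]
  have hrec : ∀ L, W q (S (L + 1)) * (1 - q * q ^ L) = W q (S L) * (1 - (-q) * q ^ L) := by
    intro L
    have a := (tendsto_add_atTop_iff_nat 1).2 (t1 (L + 1))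
    have b := ((tendsto_add_atTop_iff_nat 1).2 (t1 L)).add
      (((t1 (L + 1)).add (t1 L)).const_mul (q ^ (L + 1)))
    simp_rw [D_rec] at a
    have := tendsto_nhds_unique a b
    linear_combination this
  have s0 : W q (S 0) = 1 := by
    refine tendsto_nhds_unique (t1 0) ?_
    simp_rw [D_zero_left]
    exact tendsto_const_nhds
  have fin : ∀ L, W q (S L) * ∏ j ∈ Finset.range L, (1 - q * q ^ j) =
      ∏ j ∈ Finset.range L, (1 - (-q) * q ^ j) := by
    intro L
    induction L with
    | zero => simp [s0]
    | succ L ih =>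
      rw [Finset.prod_range_succ, Finset.prod_range_succ, ← ih]
      linear_combination (∏ j ∈ Finset.range L, (1 - q * q ^ j)) * hrec L
  have hsum : ∀ a : ℂ, ‖a‖ = ‖q‖ → Summable (fun j : ℕ => ‖-(a * q ^ j)‖) := by
    intro a _
    simp only [norm_neg, norm_mul, norm_pow]
    exact (summable_geometric_of_lt_one (norm_nonneg q) hq).mul_left _
  have hm : ∀ a : ℂ, ‖a‖ = ‖q‖ → Multipliable (fun j : ℕ => 1 - a * q ^ j) := by
    intro a ha
    simpa [sub_eq_add_neg] using multipliable_one_add_of_summable (hsum a ha)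
  have hne : ∏' j : ℕ, (1 - q * q ^ j) ≠ 0 := by
    have := tprod_one_add_ne_zero_of_summable (f := fun j : ℕ => -(q * q ^ j)) (fun j => ?_)
      (hsum q rfl)
    · simpa [sub_eq_add_neg] using this
    · rw [← sub_eq_add_neg, sub_ne_zero]
      intro h
      have h' := congrArg norm h
      rw [norm_one, ← pow_succ', norm_pow] at h'
      have := pow_lt_one₀ (norm_nonneg q) hq (Nat.succ_ne_zero j)
      simp only [Nat.succ_eq_add_one] at this
      linarith
  rw [eq_div_iff hne]
  refine tendsto_nhds_unique (t2.mul (hm q rfl).hasProd.tendsto_prod_nat) ?_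
  simp_rw [fin]
  exact (hm (-q) (norm_neg q)).hasProd.tendsto_prod_nat

end OPProof

namespace OPProof

lemma hasSum_of_eq {u v : ℕ → ℂ} {a : ℂ} (h : HasSum u a) (e : ∀ n, v n = u n) : HasSum v a := by
  rwa [funext e]

noncomputable def G (q : ℂ) (h : ℕ) : ℂ := W q {p | h + cd p ≤ sp p}
noncomputable def H (q : ℂ) (j : ℕ) : ℂ := W q {p | sp p ≤ cd p + j}

lemma sp_eq_zero_of_cd {p : Om} (h : cd p = 0) : sp p = 0 := by
  unfold cd at h
  rw [Multiset.card_eq_zero] at h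
  simp [sp, h]

lemma sum_sdiff_D (q : ℂ) {L L' k k' : ℕ} (hL : L ≤ L') (hk : k ≤ k') :
    ∑ p ∈ OP L' k' \ OP L k, f q p = D q L' k' - D q L k := by
  rw [Finset.sum_sdiff_eq_sub (OP_mono hL hk)]
  congr 1 <;> exact Finset.sum_congr rfl fun p hp => f_of_mem hp

lemma hasSum_G {q : ℂ} (hq : ‖q‖ < 1) {h : ℕ} (hh : 1 ≤ h) :
    HasSum (fun k => q ^ (k + h + 1) * (D q (k + h + 1) k + D q (k + h) k)) (G q h) := by
  have := hasSum_fib hq {p | h + cd p ≤ sp p}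
    (fun k => OP (k + h + 1) (k + 1) \ OP (k + h) (k + 1)) (fun p => sp p - h - 1) ?_
  · unfold G
    convert this using 1
    funext k
    rw [sum_sdiff_D q (Nat.le_succ _) le_rfl, D_rec]
    ring
  · intro c p
    simp only [Finset.mem_sdiff, mem_OP', Set.mem_ofPred_eq]
    have h0 := @sp_eq_zero_of_cd p
    constructor
    · rintro ⟨⟨h1, h2, h3⟩, h4⟩
      have : ¬ (sp p ≤ c + h) := fun hc => h4 ⟨h1, hc, h3⟩
      refine ⟨⟨?_, h1⟩, ?_⟩ <;> omega
    · rintro ⟨⟨h1, h2⟩, h3⟩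
      have : sp p ≠ h := by
        intro hc
        have := h0 (by omega)
        omega
      refine ⟨⟨h2, ?_, ?_⟩, ?_⟩
      · omega
      · omega
      · rintro ⟨_, h5, _⟩
        omega

lemma hasSum_H {q : ℂ} (hq : ‖q‖ < 1) (i : ℕ) :
    HasSum (fun k => q ^ k * (D q (k + i) k + if k = 0 then 0 else D q (k + i) (k - 1)))
      (H q (i + 1)) := by
  have := hasSum_fib hq {p | sp p ≤ cd p + (i + 1)}
    (fun k => if k = 0 then OP 0 0 else OP (k + i + 1) k \ OP (k + i + 1) (k - 1)) cd ?_
  · unfold H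
    convert this using 1
    funext k
    cases k with
    | zero => simp [D_zero_right, OP, f, Valid, wt]
    | succ k =>
      simp only [Nat.succ_ne_zero, if_false, Nat.add_sub_cancel]
      rw [sum_sdiff_D q le_rfl (Nat.le_succ _), D_rec']
      ring
  · intro c p
    have h0 := @sp_eq_zero_of_cd p
    simp only [Set.mem_ofPred_eq]
    by_cases hc : c = 0
    · simp only [hc, if_true, mem_OP']
      constructor
      · rintro ⟨h1, h2, h3⟩
        refine ⟨⟨?_, h1⟩, ?_⟩ <;> omega
      · rintro ⟨⟨h1, h2⟩, h3⟩
        have := h0 h3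
        refine ⟨h2, ?_, ?_⟩ <;> omega
    · simp only [hc, if_false, mem_OP', Finset.mem_sdiff]
      constructor
      · rintro ⟨⟨h1, h2, h3⟩, h4⟩
        have : ¬ (cd p ≤ c - 1) := fun hc => h4 ⟨h1, h2, hc⟩
        refine ⟨⟨?_, h1⟩, ?_⟩ <;> omega
      · rintro ⟨⟨h1, h2⟩, h3⟩
        refine ⟨⟨h2, ?_, ?_⟩, ?_⟩
        · omega
        · omega
        · rintro ⟨_, _, h5⟩
          omega

lemma G_add_H {q : ℂ} (hq : ‖q‖ < 1) (h : ℕ) : G q (h + 1) + H q h = W q Set.univ := by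
  unfold G H
  rw [← W_add hq]
  · congr 1
    ext p
    simp only [Set.mem_union, Set.mem_ofPred_eq, Set.mem_univ, iff_true]
    omega
  · rw [Set.disjoint_left]
    intro p
    simp only [Set.mem_ofPred_eq]
    omega

lemma G_rec {q : ℂ} (hq : ‖q‖ < 1) {h : ℕ} (hh : 1 ≤ h) :
    G q h + G q (h + 1) = q ^ (h + 1) * (2 * W q Set.univ - G q (h + 2) - G q (h + 3)) := by
  have a := hasSum_G hq hh
  have b := hasSum_G hq (show 1 ≤ h + 1 by omega)
  have c := ((hasSum_H hq h).add (hasSum_H hq (h + 1))).mul_left (q ^ (h + 1))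
  have e1 := G_add_H hq (h + 1)
  have e2 := G_add_H hq (h + 2)
  have b' : HasSum (fun k => if k = 0 then 0 else
      q ^ (k + h + 1) * (D q (k + h + 1) (k - 1) + D q (k + h) (k - 1))) (G q (h + 1)) := by
    rw [← hasSum_nat_add_iff' 1]
    simp only [Nat.succ_ne_zero, if_false, Nat.add_sub_cancel, Finset.range_one,
      Finset.sum_singleton, if_true, sub_zero]
    refine hasSum_of_eq b fun k => ?_
    rw [show k + 1 + h = k + (h + 1) by ring]
  have d := a.add b'
  have : G q h + G q (h + 1) = q ^ (h + 1) * (H q (h + 1) + H q (h + 1 + 1)) := by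
    refine d.unique ?_
    refine hasSum_of_eq c fun k => ?_
    cases k with
    | zero => simp [D_zero_right]
    | succ k =>
      simp only [Nat.succ_ne_zero, if_false, Nat.add_sub_cancel]
      rw [show k + 1 + (h + 1) = k + 1 + h + 1 by ring]
      ring
  rw [this]
  linear_combination q ^ (h + 1) * (e1 + e2)

lemma G_bound {q : ℂ} (hq : ‖q‖ < 1) : ∃ K : ℝ, ∀ h, 1 ≤ h → ‖G q h‖ ≤ K * ‖q‖ ^ h := by
  obtain ⟨M, hM0, hM⟩ := D_bound (norm_nonneg q) hq
  refine ⟨2 * M * (1 - ‖q‖)⁻¹, fun h hh => ?_⟩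
  have hg := (hasSum_geometric_of_lt_one (norm_nonneg q) hq).mul_left (2 * M * ‖q‖ ^ h)
  rw [← (hasSum_G hq hh).tsum_eq]
  refine (tsum_of_norm_bounded hg fun k => ?_).trans (le_of_eq (by ring))
  rw [norm_mul, norm_pow]
  have h1 : ‖D q (k + h + 1) k + D q (k + h) k‖ ≤ 2 * M := by
    refine (norm_add_le _ _).trans ?_
    have := (norm_D_le q (k + h + 1) k).trans (hM _ _)
    have := (norm_D_le q (k + h) k).trans (hM _ _)
    linarith
  have h2 : ‖q‖ ^ (k + h + 1) ≤ ‖q‖ ^ (k + h) :=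
    pow_le_pow_of_le_one (norm_nonneg q) hq.le (Nat.le_succ _)
  calc _ ≤ ‖q‖ ^ (k + h) * (2 * M) := by gcongr
    _ = _ := by ring

/-! The theta-like series -/

noncomputable def Bt (q : ℂ) (h n : ℕ) : ℂ :=
  (-1 : ℂ) ^ n * q ^ ((n + 1) * (n + 1) + h * (n + 1)) / (1 + q ^ (n + 1))

lemma one_add_lower {q : ℂ} (hq : ‖q‖ < 1) (n : ℕ) : 1 - ‖q‖ ≤ ‖1 + q ^ (n + 1)‖ := by
  have h1 : ‖q ^ (n + 1)‖ ≤ ‖q‖ := by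
    rw [norm_pow]
    simpa using pow_le_pow_of_le_one (norm_nonneg q) hq.le (show 1 ≤ n + 1 by omega)
  have := norm_sub_le (1 + q ^ (n + 1)) (q ^ (n + 1))
  rw [add_sub_cancel_right, norm_one] at this
  linarith

lemma one_add_ne {q : ℂ} (hq : ‖q‖ < 1) (n : ℕ) : 1 + q ^ (n + 1) ≠ 0 := by
  rw [← norm_pos_iff]
  have := one_add_lower hq n
  linarith

lemma Bt_norm {q : ℂ} (hq : ‖q‖ < 1) (h n : ℕ) :
    ‖Bt q h n‖ ≤ (1 - ‖q‖)⁻¹ * ‖q‖ ^ h * ‖q‖ ^ n := by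
  unfold Bt
  have := one_add_lower hq n
  have h0 : 0 < 1 - ‖q‖ := by linarith
  rw [norm_div, norm_mul, norm_pow, norm_neg, norm_one, one_pow, one_mul, norm_pow, div_eq_inv_mul,
    mul_assoc, ← pow_add]
  have h2 : ‖q‖ ^ ((n + 1) * (n + 1) + h * (n + 1)) ≤ ‖q‖ ^ (h + n) :=
    pow_le_pow_of_le_one (norm_nonneg q) hq.le (by nlinarith)
  have h3 : ‖1 + q ^ (n + 1)‖⁻¹ ≤ (1 - ‖q‖)⁻¹ := by gcongr
  gcongr

lemma summable_Bt {q : ℂ} (hq : ‖q‖ < 1) (h : ℕ) : Summable (Bt q h) :=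
  Summable.of_norm_bounded ((summable_geometric_of_lt_one (norm_nonneg q) hq).mul_left _)
    (Bt_norm hq h)

noncomputable def B (q : ℂ) (h : ℕ) : ℂ := ∑' n, Bt q h n

lemma B_bound {q : ℂ} (hq : ‖q‖ < 1) (h : ℕ) :
    ‖B q h‖ ≤ (1 - ‖q‖)⁻¹ * (1 - ‖q‖)⁻¹ * ‖q‖ ^ h := by
  have hg := (hasSum_geometric_of_lt_one (norm_nonneg q) hq).mul_left ((1 - ‖q‖)⁻¹ * ‖q‖ ^ h)
  exact (tsum_of_norm_bounded hg (Bt_norm hq h)).trans (le_of_eq (by ring))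

lemma B_rec {q : ℂ} (hq : ‖q‖ < 1) (h : ℕ) :
    B q h + B q (h + 1) = q ^ (h + 1) * (1 - B q (h + 2) - B q (h + 3)) := by
  have e : ∀ h, HasSum (fun n : ℕ => (-1 : ℂ) ^ n * q ^ ((n + 1) * (n + 1) + h * (n + 1)))
      (B q h + B q (h + 1)) := by
    intro h
    refine hasSum_of_eq ((summable_Bt hq h).hasSum.add (summable_Bt hq (h + 1)).hasSum) fun n => ?_
    unfold Bt
    have := one_add_ne hq n
    rw [← add_div, eq_div_iff this]
    ring
  have a := e h
  have b := (e (h + 2)).mul_left (-q ^ (h + 1))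
  rw [← hasSum_nat_add_iff' 1] at a
  have c : B q h + B q (h + 1) - ∑ i ∈ Finset.range 1,
      (-1 : ℂ) ^ i * q ^ ((i + 1) * (i + 1) + h * (i + 1)) =
      -q ^ (h + 1) * (B q (h + 2) + B q (h + 2 + 1)) := by
    refine a.unique ?_
    refine hasSum_of_eq b fun n => ?_
    ring
  simp only [Finset.range_one, Finset.sum_singleton] at c
  simp only [pow_zero, one_mul, zero_add, mul_one] at c
  linear_combination c

lemma G_eq {q : ℂ} (hq : ‖q‖ < 1) {h : ℕ} (hh : 1 ≤ h) : G q h = 2 * W q Set.univ * B q h := by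
  obtain ⟨K, hK⟩ := G_bound hq
  set P := W q Set.univ with hP
  set E : ℕ → ℂ := fun h => G q h - 2 * P * B q h with hE
  have hgeo := tendsto_pow_atTop_nhds_zero_of_lt_one (norm_nonneg q) hq
  have hE0 : Tendsto E atTop (nhds 0) := by
    have t1 : Tendsto (G q) atTop (nhds 0) := by
      refine squeeze_zero_norm' ?_ (by simpa using hgeo.const_mul K)
      filter_upwards [eventually_ge_atTop 1] with n hn using hK n hn
    have t2 : Tendsto (B q) atTop (nhds 0) := by
      refine squeeze_zero_norm (B_bound hq) (by simpa using hgeo.const_mul _)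
    simpa using t1.sub (t2.const_mul (2 * P))
  set S : ℕ → ℂ := fun h => E h + E (h + 1) with hS
  have hS0 : Tendsto S atTop (nhds 0) := by
    simpa using hE0.add ((tendsto_add_atTop_iff_nat 1).2 hE0)
  have hSrec : ∀ h, 1 ≤ h → S h = -q ^ (h + 1) * S (h + 2) := by
    intro h hh
    have a := G_rec hq hh
    have b := B_rec hq h
    simp only [hS, hE]
    rw [← hP] at a
    linear_combination a - 2 * P * b
  have hSz : ∀ h, 1 ≤ h → S h = 0 := by
    intro h hh
    have mono : ∀ j : ℕ, ‖S h‖ ≤ ‖S (h + 2 * j)‖ := by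
      intro j
      induction j with
      | zero => simp
      | succ j ih =>
        refine ih.trans ?_
        rw [hSrec (h + 2 * j) (by omega), norm_mul, norm_neg, norm_pow]
        have : ‖q‖ ^ (h + 2 * j + 1) ≤ 1 := pow_le_one₀ (norm_nonneg q) hq.le
        rw [show h + 2 * (j + 1) = h + 2 * j + 2 by ring]
        exact mul_le_of_le_one_left (norm_nonneg _) this
    have lim : Tendsto (fun j : ℕ => ‖S (h + 2 * j)‖) atTop (nhds 0) := by
      have := hS0.norm.comp (tendsto_atTop_mono (fun j : ℕ => (by omega : j ≤ h + 2 * j)) tendsto_id)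
      simpa [Function.comp_def] using this
    have := ge_of_tendsto' lim mono
    simpa using this
  have mono : ∀ j : ℕ, ‖E h‖ = ‖E (h + j)‖ := by
    intro j
    induction j with
    | zero => simp
    | succ j ih =>
      rw [ih, eq_neg_of_add_eq_zero_left (hSz (h + j) (by omega)), norm_neg, add_assoc]
  have lim : Tendsto (fun j : ℕ => ‖E (h + j)‖) atTop (nhds 0) := by
    have := hE0.norm.comp (tendsto_atTop_mono (fun j : ℕ => (by omega : j ≤ h + j)) tendsto_id)
    simpa [Function.comp_def] using this
  have : ‖E h‖ ≤ 0 := ge_of_tendsto' lim fun j => (mono j).le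
  have : E h = 0 := by simpa using this
  exact sub_eq_zero.1 this

end OPProof

namespace OPProof

lemma wt_eq (p : Om) : wt p = (p.1.val + p.2).sum := by
  rw [Multiset.sum_add, Finset.sum_val]; rfl

lemma sp_le_wt (p : Om) : sp p ≤ wt p := by
  rw [wt_eq, sp, Multiset.sup_le]
  intro i hi
  exact Multiset.le_sum_of_mem hi

lemma cd_le_wt {p : Om} (hp : Valid p) : cd p ≤ wt p := by
  rw [wt_eq, cd]
  have := Multiset.card_nsmul_le_sum (s := p.1.val + p.2) (a := 1) fun i hi => by
    rcases Multiset.mem_add.1 hi with h | h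
    · exact hp.1 i h
    · exact hp.2 i h
  simpa using this

def TN (m n : ℕ) : Finset Om := (OP n n).filter fun p => wt p = n ∧ sp p = cd p + m

lemma mem_TN (m n : ℕ) (p : Om) : p ∈ TN m n ↔ (sp p = cd p + m ∧ Valid p) ∧ wt p = n := by
  rw [TN, Finset.mem_filter, mem_OP']
  constructor
  · rintro ⟨⟨h1, _, _⟩, h2, h3⟩
    exact ⟨⟨h3, h1⟩, h2⟩
  · rintro ⟨⟨h3, h1⟩, h2⟩
    exact ⟨⟨h1, h2 ▸ sp_le_wt p, h2 ▸ cd_le_wt h1⟩, h2, h3⟩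

lemma Nbar_eq (m n : ℕ) : Nbar (m : ℤ) n = (TN m n).card := by
  have e : {p : Overpartition n // p.rank = m} ≃ {x // x ∈ TN m n} :=
    { toFun := fun p => ⟨(p.1.overlined, p.1.nonoverlined), by
        rw [mem_TN]
        refine ⟨⟨?_, p.1.overlined_pos, p.1.nonoverlined_pos⟩, p.1.total⟩
        have := p.2
        simp only [Overpartition.rank, Overpartition.parts] at this
        simp only [sp, cd]
        omega⟩
      invFun := fun x => ⟨⟨x.1.1, x.1.2, ((mem_TN _ _ _).1 x.2).1.2.1, ((mem_TN _ _ _).1 x.2).1.2.2,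
        ((mem_TN _ _ _).1 x.2).2⟩, by
        have := ((mem_TN _ _ _).1 x.2).1.1
        simp only [Overpartition.rank, Overpartition.parts]
        simp only [sp, cd] at this
        omega⟩
      left_inv := fun p => rfl
      right_inv := fun x => rfl }
  rw [Nbar, Nat.card_congr e, Nat.card_eq_fintype_card, Fintype.card_coe]

lemma hasSum_Nbar {q : ℂ} (hq : ‖q‖ < 1) (m : ℕ) :
    HasSum (fun n => (Nbar (m : ℤ) n : ℂ) * q ^ n) (G q m - G q (m + 1)) := by
  have h1 : G q m = W q {p | sp p = cd p + m} + G q (m + 1) := by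
    unfold G
    rw [← W_add hq]
    · congr 1
      ext p
      simp only [Set.mem_union, Set.mem_ofPred_eq]
      omega
    · rw [Set.disjoint_left]
      intro p
      simp only [Set.mem_ofPred_eq]
      omega
  rw [h1, add_sub_cancel_right]
  refine hasSum_of_eq (hasSum_fib hq {p | sp p = cd p + m} (TN m) wt (fun c p => mem_TN m c p))
    fun n => ?_
  rw [Nbar_eq, ← nsmul_eq_mul, ← Finset.sum_const]
  refine Finset.sum_congr rfl fun p hp => ?_
  have hp := (mem_TN _ _ _).1 hp
  simp [f, hp.1.2, hp.2]

lemma hasSum_choose_shift (s d : ℕ) {x : ℂ} (hx : ‖x‖ < 1) :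
    HasSum (fun m : ℕ => ((m + 1 + s).choose (s + 1 + d) : ℂ) * x ^ (m + 1))
      (x ^ (d + 1) / (1 - x) ^ (s + 1 + d + 1)) := by
  rw [← hasSum_nat_add_iff' d]
  have h0 : ∑ m ∈ Finset.range d, ((m + 1 + s).choose (s + 1 + d) : ℂ) * x ^ (m + 1) = 0 := by
    refine Finset.sum_eq_zero fun m hm => ?_
    have := Finset.mem_range.1 hm
    rw [Nat.choose_eq_zero_of_lt (by omega)]
    simp
  rw [h0, sub_zero]
  have := (hasSum_choose_mul_geometric_of_norm_lt_one (s + 1 + d) hx).mul_left (x ^ (d + 1))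
  rw [div_eq_mul_one_div]
  refine hasSum_of_eq this fun m => ?_
  rw [show m + d + 1 + s = m + (s + 1 + d) by ring]
  ring

lemma final (s d : ℕ) {q : ℂ} (hq : ‖q‖ < 1) :
    ∑' n : ℕ, ∑' m : ℕ, ((m + 1 + s).choose (s + 1 + d) : ℂ) * (Nbar ((m + 1 : ℕ) : ℤ) n : ℂ) * q ^ n =
      2 * W q Set.univ * ∑' n : ℕ, (-1 : ℂ) ^ n * q ^ ((n + 1) * (n + 1) + (d + 1) * (n + 1)) /
            ((1 + q ^ (n + 1)) * (1 - q ^ (n + 1)) ^ (s + 1 + d)) := by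
  set c : ℕ → ℂ := fun m => ((m + 1 + s).choose (s + 1 + d) : ℂ) with hc
  have hx0 := norm_nonneg q
  have hxn : ‖((‖q‖ : ℝ) : ℂ)‖ = ‖q‖ := by simp
  have hcs : Summable (fun m => ‖c m‖ * ‖q‖ ^ (m + 1)) := by
    have := (hasSum_choose_shift s d (x := ((‖q‖ : ℝ) : ℂ)) (by rwa [hxn])).summable.norm
    refine this.congr fun m => ?_
    rw [norm_mul, norm_pow, hxn]
  -- first interchange
  have sum1 : Summable (Function.uncurry fun m n : ℕ => c m * (Nbar ((m + 1 : ℕ) : ℤ) n : ℂ) * q ^ n) := by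
    obtain ⟨K, hK⟩ := G_bound (q := ((‖q‖ : ℝ) : ℂ)) (by rwa [hxn])
    rw [hxn] at hK
    have hN : ∀ m : ℕ, HasSum (fun n => ‖c m * (Nbar ((m + 1 : ℕ) : ℤ) n : ℂ) * q ^ n‖)
        (‖c m‖ * ‖G ((‖q‖ : ℝ) : ℂ) (m + 1) - G ((‖q‖ : ℝ) : ℂ) (m + 1 + 1)‖) := by
      intro m
      have a := hasSum_Nbar (q := ((‖q‖ : ℝ) : ℂ)) (by rwa [hxn]) (m + 1)
      have a' : HasSum (fun n => (((Nbar ((m + 1 : ℕ) : ℤ) n : ℝ) * ‖q‖ ^ n : ℝ) : ℂ))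
          (G ((‖q‖ : ℝ) : ℂ) (m + 1) - G ((‖q‖ : ℝ) : ℂ) (m + 1 + 1)) := by
        refine hasSum_of_eq a fun n => ?_
        push_cast; rfl
      have hs : Summable (fun n => (Nbar ((m + 1 : ℕ) : ℤ) n : ℝ) * ‖q‖ ^ n) :=
        Complex.summable_ofReal.1 a'.summable
      have e : G ((‖q‖ : ℝ) : ℂ) (m + 1) - G ((‖q‖ : ℝ) : ℂ) (m + 1 + 1) =
          ((∑' n, (Nbar ((m + 1 : ℕ) : ℤ) n : ℝ) * ‖q‖ ^ n : ℝ) : ℂ) := by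
        rw [← a'.tsum_eq, Complex.ofReal_tsum]
      rw [e, Complex.norm_real, Real.norm_of_nonneg (tsum_nonneg fun n => by positivity)]
      have := hs.hasSum.mul_left ‖c m‖
      suffices e2 : (fun n => ‖c m * (Nbar ((m + 1 : ℕ) : ℤ) n : ℂ) * q ^ n‖) =
          fun n => ‖c m‖ * ((Nbar ((m + 1 : ℕ) : ℤ) n : ℝ) * ‖q‖ ^ n) by
        rw [e2]; exact this
      funext n
      rw [norm_mul, norm_mul, norm_pow, mul_assoc, Complex.norm_natCast (Nbar _ _)]
    refine Summable.of_norm ?_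
    rw [summable_prod_of_nonneg (fun _ => norm_nonneg _)]
    refine ⟨fun m => (hN m).summable, ?_⟩
    simp only [Function.uncurry]
    simp_rw [fun m => (hN m).tsum_eq]
    refine Summable.of_nonneg_of_le (fun m => by positivity) (fun m => ?_) (hcs.mul_left (2 * K))
    have h1 := hK (m + 1) (by omega)
    have h2 := hK (m + 1 + 1) (by omega)
    have hK0 : 0 ≤ K * ‖q‖ ^ (m + 1) := (norm_nonneg _).trans h1
    have h3 : K * ‖q‖ ^ (m + 1 + 1) ≤ K * ‖q‖ ^ (m + 1) := by
      rw [pow_succ, ← mul_assoc]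
      exact mul_le_of_le_one_right hK0 hq.le
    have h4 := norm_sub_le (G ((‖q‖ : ℝ) : ℂ) (m + 1)) (G ((‖q‖ : ℝ) : ℂ) (m + 1 + 1))
    calc _ ≤ ‖c m‖ * (2 * (K * ‖q‖ ^ (m + 1))) := by gcongr; linarith
      _ = _ := by ring
  rw [sum1.tsum_comm]
  have in1 : ∀ m, ∑' n, c m * (Nbar ((m + 1 : ℕ) : ℤ) n : ℂ) * q ^ n =
      2 * W q Set.univ * ∑' n, c m * (Bt q (m + 1) n - Bt q (m + 2) n) := by
    intro m
    simp_rw [mul_assoc (c m)]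
    rw [tsum_mul_left, tsum_mul_left, (hasSum_Nbar hq (m + 1)).tsum_eq, G_eq hq (by omega),
      G_eq hq (by omega), (summable_Bt hq (m + 1)).tsum_sub (summable_Bt hq (m + 2))]
    unfold B
    ring
  simp_rw [in1]
  rw [tsum_mul_left]
  congr 1
  have sum2 : Summable (Function.uncurry fun m n : ℕ => c m * (Bt q (m + 1) n - Bt q (m + 2) n)) := by
    have hg := summable_geometric_of_lt_one hx0 hq
    have := (Summable.mul_of_nonneg hcs hg (fun m => by positivity) (fun n => by positivity)).mul_left
      (2 * (1 - ‖q‖)⁻¹)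
    refine Summable.of_norm_bounded this ?_
    rintro ⟨m, n⟩
    simp only [Function.uncurry]
    rw [norm_mul]
    have h0 : 0 < 1 - ‖q‖ := by linarith
    have h1 := Bt_norm hq (m + 1) n
    have h2 := Bt_norm hq (m + 2) n
    have h3 : (1 - ‖q‖)⁻¹ * ‖q‖ ^ (m + 2) * ‖q‖ ^ n ≤ (1 - ‖q‖)⁻¹ * ‖q‖ ^ (m + 1) * ‖q‖ ^ n := by
      have : ‖q‖ ^ (m + 2) ≤ ‖q‖ ^ (m + 1) := pow_le_pow_of_le_one hx0 hq.le (by omega)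
      gcongr
    have h4 := norm_sub_le (Bt q (m + 1) n) (Bt q (m + 2) n)
    calc _ ≤ ‖c m‖ * (2 * ((1 - ‖q‖)⁻¹ * ‖q‖ ^ (m + 1) * ‖q‖ ^ n)) := by gcongr; linarith
      _ = _ := by ring
  rw [← sum2.tsum_comm]
  refine tsum_congr fun n => ?_
  have hxn1 : ‖q ^ (n + 1)‖ < 1 := by
    rw [norm_pow]; exact pow_lt_one₀ hx0 hq (Nat.succ_ne_zero n)
  have ha := one_add_ne hq n
  have hb : 1 - q ^ (n + 1) ≠ 0 := by
    rw [sub_ne_zero]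
    intro h
    rw [← h, norm_one] at hxn1
    exact lt_irrefl _ hxn1
  have := (hasSum_choose_shift s d hxn1).mul_left
    ((-1 : ℂ) ^ n * q ^ ((n + 1) * (n + 1)) * (1 - q ^ (n + 1)) / (1 + q ^ (n + 1)))
  refine (HasSum.tsum_eq (hasSum_of_eq this fun m => ?_)).trans ?_
  · simp only [hc, Bt]
    rw [← sub_div, mul_div_assoc', div_mul_eq_mul_div]
    congr 1
    ring
  · have e : q ^ ((n + 1) * (n + 1) + (d + 1) * (n + 1)) =
        q ^ ((n + 1) * (n + 1)) * (q ^ (n + 1)) ^ (d + 1) := by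
      rw [← pow_mul, ← pow_add, mul_comm (d + 1)]
    rw [e]
    generalize q ^ (n + 1) = y at *
    rw [pow_succ (1 - y) (s + 1 + d)]
    field_simp

end OPProof

/-- Generating function of the positive symmetrized rank moments:
`Σ_{n≥0} η̄_r^+(n) q^n = 2((-q;q)_∞/(q;q)_∞) Σ_{n≥1} (-1)^{n+1} q^{n²+(r/2+ρ_R)n}/((1+q^n)(1-q^n)^r)`,
all exponents being nonnegative integers. -/
theorem rank_symmetrized_genfun (r : ℕ) (hr : 1 ≤ r) (q : ℂ) (hq : ‖q‖ < 1) :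
    (∀ n : ℕ, 1 ≤ n → (2 * n * n + r * n + (if r % 2 = 1 then n else 2 * n)) % 2 = 0) ∧
      (∑' n : ℕ, ((etabar r n : ℝ) : ℂ) * q ^ n) =
        2 * (poch (-q) q / poch q q) *
          ∑' n : ℕ, (-1 : ℂ) ^ n * q ^ eR r (n + 1) /
            ((1 + q ^ (n + 1)) * (1 - q ^ (n + 1)) ^ r) := by
  have hd : ∃ s d : ℕ, (r - 1) / 2 = s ∧ r = s + 1 + d ∧
      ((r % 2 = 1 ∧ r + 1 = 2 * (d + 1)) ∨ (r % 2 = 0 ∧ r + 2 = 2 * (d + 1))) :=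
    ⟨(r - 1) / 2, r - 1 - (r - 1) / 2, rfl, by omega, by omega⟩
  obtain ⟨s, d, hs, hrd, hpar⟩ := hd
  have key : ∀ n : ℕ, 2 * n * n + r * n + (if r % 2 = 1 then n else 2 * n) =
      2 * (n * n + (d + 1) * n) := by
    intro n
    rcases hpar with ⟨h1, h2⟩ | ⟨h1, h2⟩
    · rw [if_pos h1]
      linear_combination n * h2
    · rw [if_neg (by omega)]
      linear_combination n * h2
  refine ⟨fun n _ => by rw [key]; omega, ?_⟩
  have hP : poch (-q) q / poch q q = OPProof.W q Set.univ := (OPProof.W_univ hq).symm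
  have heR : ∀ n, eR r n = n * n + (d + 1) * n := by
    intro n
    rw [eR, key]
    omega
  simp_rw [hP, heR]
  have := OPProof.final s d hq
  rw [← hrd] at this
  rw [← this]
  refine tsum_congr fun n => ?_
  rw [tsum_mul_right, etabar, Complex.ofReal_tsum, hs]
  congr 1
  refine tsum_congr fun m => ?_
  push_cast
  rfl
end
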